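/- arXiv:0812.0077 — 9 statements merged into one kernel-verified Lean document; each statement's English description precedes it below -/
import Mathlib

section
/- Let B be a unital C*-algebra and for i = 1,2 let 𝔗^i be a spatial CPD-semigroup on a set S^i with unit 𝔖^i implemented by norm-continuous semigroups (c^{i,s})_{s∈S^i} in B. Define the Powers sum 𝔗 = 𝔗¹ ⊞ 𝔗² on the disjoint union S = S¹ ⊔ S² by 𝔗_t^{s,s'} := (𝔗^i)_t^{s,s'} for s, s' ∈ S^i, and 𝔗_t^{s,s'}(b) := (c^{i,s}_t)* b c^{j,s'}_t for s ∈ S^i, s' ∈ S^j with i ≠ j. Then 𝔗 is a CPD-semigroup on S (each 𝔗_t is a CPD kernel, 𝔗_0^{s,s'} = id_B, and 𝔗_{t+u}^{s,s'} = 𝔗_t^{s,s'} ∘ 𝔗_u^{s,s'} for all s,s' ∈ S), and the elementary CPD-semigroup 𝔖 = 𝔖¹ ⊞ 𝔖² implemented by the combined family of semigroups is a unit for 𝔗; in particular, 𝔗 is spatial. -/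
open scoped NNReal

/-- A kernel `K` on a set `S` with values in the bounded linear maps on a unital
C*-algebra `B` is *completely positive definite* (CPD) if all finite sums
`∑_{i,j} bᵢ* K^{sᵢ,sⱼ}(aᵢ* aⱼ) bⱼ` are positive, i.e. of the form `y* y`. -/
def IsCPDKernel {S : Type*} {B : Type*} [CStarAlgebra B]
    (K : S → S → B →L[ℂ] B) : Prop :=
  ∀ (n : ℕ) (s : Fin n → S) (a b : Fin n → B),
    ∃ y : B, ∑ i, ∑ j, star (b i) * K (s i) (s j) (star (a i) * a j) * b j = star y * y

/-- A CPD-semigroup on `S`: a family of CPD-kernels with `𝔗₀ = id` and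
`𝔗_{t+u}^{s,s'} = 𝔗_t^{s,s'} ∘ 𝔗_u^{s,s'}`. -/
def IsCPDSemigroup {S : Type*} {B : Type*} [CStarAlgebra B]
    (T : ℝ≥0 → S → S → B →L[ℂ] B) : Prop :=
  (∀ t, IsCPDKernel (T t)) ∧
  (∀ s s', T 0 s s' = ContinuousLinearMap.id ℂ B) ∧
  (∀ t u s s', T (t + u) s s' = (T t s s').comp (T u s s'))

/-- A one-parameter semigroup in `B`. -/
def IsOneParamSemigroup {B : Type*} [CStarAlgebra B] (c : ℝ≥0 → B) : Prop :=
  c 0 = 1 ∧ ∀ t u, c (t + u) = c t * c u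

/-- The elementary CPD-semigroup implemented by the family of semigroups `c`:
`𝔖_t^{s,s'}(b) = (c^s_t)* b (c^{s'}_t)`. -/
noncomputable def elemCPD {S : Type*} {B : Type*} [CStarAlgebra B]
    (c : S → ℝ≥0 → B) (t : ℝ≥0) (s s' : S) : B →L[ℂ] B :=
  ContinuousLinearMap.mulLeftRight ℂ B (star (c s t)) (c s' t)

/-- The family `c` of norm-continuous one-parameter semigroups implements a *unit*
for the CPD-semigroup `T`, i.e. `T` dominates the elementary CPD-semigroup of `c`. -/
def IsUnitFor {S : Type*} {B : Type*} [CStarAlgebra B]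
    (c : S → ℝ≥0 → B) (T : ℝ≥0 → S → S → B →L[ℂ] B) : Prop :=
  (∀ s, Continuous (c s) ∧ IsOneParamSemigroup (c s)) ∧
  (∀ t, IsCPDKernel (fun s s' => T t s s' - elemCPD c t s s'))

/-- A CPD-semigroup is *spatial* if it admits a unit. -/
def IsSpatialCPDSemigroup {S : Type*} {B : Type*} [CStarAlgebra B]
    (T : ℝ≥0 → S → S → B →L[ℂ] B) : Prop :=
  ∃ c, IsUnitFor c T

/-- The Powers sum `𝔗¹ ⊞ 𝔗²` of two CPD-semigroups on `S₁`, `S₂` with respect to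
implementing semigroups `c₁`, `c₂`. -/
noncomputable def powersSumCPD {S₁ S₂ : Type*} {B : Type*} [CStarAlgebra B]
    (T₁ : ℝ≥0 → S₁ → S₁ → B →L[ℂ] B) (T₂ : ℝ≥0 → S₂ → S₂ → B →L[ℂ] B)
    (c₁ : S₁ → ℝ≥0 → B) (c₂ : S₂ → ℝ≥0 → B)
    (t : ℝ≥0) : S₁ ⊕ S₂ → S₁ ⊕ S₂ → B →L[ℂ] B :=
  fun s s' =>
    match s, s' with
    | Sum.inl s, Sum.inl s' => T₁ t s s'
    | Sum.inr s, Sum.inr s' => T₂ t s s'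
    | Sum.inl s, Sum.inr s' => ContinuousLinearMap.mulLeftRight ℂ B (star (c₁ s t)) (c₂ s' t)
    | Sum.inr s, Sum.inl s' => ContinuousLinearMap.mulLeftRight ℂ B (star (c₂ s t)) (c₁ s' t)

/-- The sum of two CPD-kernels is CPD. -/
theorem IsCPDKernel.add {S B : Type*} [CStarAlgebra B] {K L : S → S → B →L[ℂ] B}
    (hK : IsCPDKernel K) (hL : IsCPDKernel L) :
    IsCPDKernel (fun s s' => K s s' + L s s') := by
  intro n s a b
  let := CStarAlgebra.spectralOrder B
  have := CStarAlgebra.spectralOrderedRing B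
  obtain ⟨y, hy⟩ := hK n s a b
  obtain ⟨z, hz⟩ := hL n s a b
  obtain ⟨w, hw⟩ := CStarAlgebra.nonneg_iff_eq_star_mul_self.mp
    (add_nonneg (star_mul_self_nonneg y) (star_mul_self_nonneg z))
  refine ⟨w, ?_⟩
  rw [← hw, ← hy, ← hz]
  simp only [add_apply, mul_add, add_mul, Finset.sum_add_distrib]

/-- The kernel of an elementary CPD-semigroup at each time is CPD. -/
theorem isCPDKernel_elemCPD {S B : Type*} [CStarAlgebra B] (c : S → ℝ≥0 → B) (t : ℝ≥0) :
    IsCPDKernel (elemCPD c t) := by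
  intro n s a b
  refine ⟨∑ i, a i * c (s i) t * b i, ?_⟩
  simp only [star_sum, Finset.sum_mul_sum, star_mul, elemCPD,
    ContinuousLinearMap.mulLeftRight_apply, mul_assoc]

/-- The extension of a kernel on `S` by zero along a partial map `f : S' → Option S`. -/
noncomputable def extendKernel {S S' B : Type*} [CStarAlgebra B] (f : S' → Option S)
    (K : S → S → B →L[ℂ] B) (s s' : S') : B →L[ℂ] B :=
  match f s, f s' with
  | some x, some y => K x y
  | _, _ => 0

/-- Extending a CPD-kernel by zero gives a CPD-kernel. -/
theorem IsCPDKernel.extendKernel {S S' B : Type*} [CStarAlgebra B] (f : S' → Option S)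
    {K : S → S → B →L[ℂ] B} (hK : IsCPDKernel K) : IsCPDKernel (extendKernel f K) := by
  intro n s a b
  rcases isEmpty_or_nonempty S with hS | ⟨⟨x₀⟩⟩
  · refine ⟨0, ?_⟩
    have hf : ∀ x, f x = none := fun x => Subsingleton.elim _ _
    simp [_root_.extendKernel, hf]
  · obtain ⟨y, hy⟩ := hK n (fun i => (f (s i)).getD x₀) a
      (fun i => if (f (s i)).isSome then b i else 0)
    refine ⟨y, hy ▸ Finset.sum_congr rfl fun i _ => Finset.sum_congr rfl fun j _ => ?_⟩
    cases hi : f (s i) <;> cases hj : f (s j) <;> simp [_root_.extendKernel, hi, hj]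

/-- The elementary maps implemented by one-parameter semigroups compose like a semigroup. -/
theorem mulLeftRight_star_add {B : Type*} [CStarAlgebra B] {c d : ℝ≥0 → B}
    (hc : IsOneParamSemigroup c) (hd : IsOneParamSemigroup d) (t u : ℝ≥0) :
    ContinuousLinearMap.mulLeftRight ℂ B (star (c (t + u))) (d (t + u)) =
      (ContinuousLinearMap.mulLeftRight ℂ B (star (c t)) (d t)).comp
        (ContinuousLinearMap.mulLeftRight ℂ B (star (c u)) (d u)) := by
  ext b
  rw [add_comm t u, hc.2, hd.2]
  simp [mul_assoc]

/-- At time zero, the elementary maps implemented by one-parameter semigroups are the identity. -/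
theorem mulLeftRight_star_zero {B : Type*} [CStarAlgebra B] {c d : ℝ≥0 → B}
    (hc : IsOneParamSemigroup c) (hd : IsOneParamSemigroup d) :
    ContinuousLinearMap.mulLeftRight ℂ B (star (c 0)) (d 0) = ContinuousLinearMap.id ℂ B := by
  ext b
  simp [hc.1, hd.1]

/-- The Powers sum dominates the elementary CPD-semigroup of the combined family. -/
theorem isCPDKernel_powersSumCPD_sub_elemCPD {S₁ S₂ B : Type*} [CStarAlgebra B]
    {T₁ : ℝ≥0 → S₁ → S₁ → B →L[ℂ] B} {T₂ : ℝ≥0 → S₂ → S₂ → B →L[ℂ] B}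
    {c₁ : S₁ → ℝ≥0 → B} {c₂ : S₂ → ℝ≥0 → B} {t : ℝ≥0}
    (h₁ : IsCPDKernel (fun s s' => T₁ t s s' - elemCPD c₁ t s s'))
    (h₂ : IsCPDKernel (fun s s' => T₂ t s s' - elemCPD c₂ t s s')) :
    IsCPDKernel (fun s s' =>
      powersSumCPD T₁ T₂ c₁ c₂ t s s' - elemCPD (Sum.elim c₁ c₂) t s s') := by
  convert (h₁.extendKernel (Sum.getLeft? : S₁ ⊕ S₂ → Option S₁)).add
    (h₂.extendKernel (Sum.getRight? : S₁ ⊕ S₂ → Option S₂)) using 3 with s s'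
  rcases s with s | s <;> rcases s' with s' | s' <;>
    simp [extendKernel, powersSumCPD, elemCPD]

/-- The Powers sum `𝔗 = 𝔗¹ ⊞ 𝔗²` of two spatial CPD-semigroups with
units implemented by `c₁`, `c₂` is a CPD-semigroup on the disjoint union, the combined
family of semigroups implements a unit for it, and in particular `𝔗` is spatial. -/
theorem powersSumCPD_isCPDSemigroup_and_spatial {S₁ S₂ : Type*} {B : Type*} [CStarAlgebra B]
    (T₁ : ℝ≥0 → S₁ → S₁ → B →L[ℂ] B) (T₂ : ℝ≥0 → S₂ → S₂ → B →L[ℂ] B)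
    (c₁ : S₁ → ℝ≥0 → B) (c₂ : S₂ → ℝ≥0 → B)
    (hT₁ : IsCPDSemigroup T₁) (hT₂ : IsCPDSemigroup T₂)
    (hc₁ : IsUnitFor c₁ T₁) (hc₂ : IsUnitFor c₂ T₂) :
    IsCPDSemigroup (powersSumCPD T₁ T₂ c₁ c₂) ∧
      IsUnitFor (Sum.elim c₁ c₂) (powersSumCPD T₁ T₂ c₁ c₂) ∧
      IsSpatialCPDSemigroup (powersSumCPD T₁ T₂ c₁ c₂) := by
  have hunit : IsUnitFor (Sum.elim c₁ c₂) (powersSumCPD T₁ T₂ c₁ c₂) :=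
    ⟨Sum.rec hc₁.1 hc₂.1, fun t => isCPDKernel_powersSumCPD_sub_elemCPD (hc₁.2 t) (hc₂.2 t)⟩
  refine ⟨⟨fun t => ?_, ?_, ?_⟩, hunit, _, hunit⟩
  · simpa only [sub_add_cancel] using
      (hunit.2 t).add (isCPDKernel_elemCPD (Sum.elim c₁ c₂) t)
  · rintro (s | s) (s' | s')
    · exact hT₁.2.1 s s'
    · exact mulLeftRight_star_zero (hc₁.1 s).2 (hc₂.1 s').2
    · exact mulLeftRight_star_zero (hc₂.1 s).2 (hc₁.1 s').2
    · exact hT₂.2.1 s s'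
  · rintro t u (s | s) (s' | s')
    · exact hT₁.2.2 t u s s'
    · exact mulLeftRight_star_add (hc₁.1 s).2 (hc₂.1 s').2 t u
    · exact mulLeftRight_star_add (hc₂.1 s).2 (hc₁.1 s').2 t u
    · exact hT₂.2.2 t u s s'
end

section
/- Let B be a unital C*-algebra, A an arbitrary index set, and for each α ∈ A let 𝔗^α be a spatial CPD-semigroup on a set S^α with unit 𝔖^α implemented by norm-continuous semigroups (c^{α,s})_{s∈S^α} in B. Define the Powers sum 𝔗 = ⊞_{α∈A} 𝔗^α on the disjoint union S = ⊔_{α∈A} S^α (the sigma type Σ α, S^α) by 𝔗_t^{(α,s),(α,s')} := (𝔗^α)_t^{s,s'} and 𝔗_t^{(α,s),(β,s')}(b) := (c^{α,s}_t)* b c^{β,s'}_t for α ≠ β. Then 𝔗 is a CPD-semigroup on S and the elementary CPD-semigroup implemented by the combined family of semigroups (c^{α,s}) is a unit for 𝔗; in particular, 𝔗 is spatial. -/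
open scoped NNReal

open Classical in
/-- The Powers sum `⊞_{α∈A} 𝔗^α` of a family of CPD-semigroups on sets `S α`, with
respect to implementing semigroups `c α`: on pairs from the same summand it is `𝔗^α`,
on mixed pairs it is given by the implementing semigroups. -/
noncomputable def powersSumFamilyCPD {A : Type*} {S : A → Type*} {B : Type*} [CStarAlgebra B]
    (T : ∀ α, ℝ≥0 → S α → S α → B →L[ℂ] B)
    (c : ∀ α, S α → ℝ≥0 → B)
    (t : ℝ≥0) : (Σ α, S α) → (Σ α, S α) → B →L[ℂ] B :=
  fun p q =>
    if h : p.1 = q.1 then T p.1 t p.2 (h.symm ▸ q.2)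
    else ContinuousLinearMap.mulLeftRight ℂ B (star (c p.1 p.2 t)) (c q.1 q.2 t)

namespace IsCPDKernel

variable {S : Type*} {B : Type*} [CStarAlgebra B]

/-- The finite sums in the definition of a CPD-kernel, over an arbitrary finite index type. -/
theorem exists_sum_eq_star_mul_self {K : S → S → B →L[ℂ] B} (hK : IsCPDKernel K)
    {ι : Type*} [Fintype ι] (s : ι → S) (a b : ι → B) :
    ∃ y : B, ∑ i, ∑ j, star (b i) * K (s i) (s j) (star (a i) * a j) * b j = star y * y := by
  let e := (Fintype.equivFin ι).symm
  obtain ⟨y, hy⟩ := hK _ (s ∘ e) (a ∘ e) (b ∘ e)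
  refine ⟨y, hy ▸ ?_⟩
  rw [← e.sum_comp]
  exact Finset.sum_congr rfl fun i _ => (e.sum_comp _).symm

/-- In a C*-algebra, finite sums of elements of the form `y* y` are again of this form. -/
theorem exists_finset_sum_eq_star_mul_self {ι : Type*} (I : Finset ι) (f : ι → B)
    (hf : ∀ i ∈ I, ∃ y : B, f i = star y * y) : ∃ y : B, ∑ i ∈ I, f i = star y * y := by
  let _ := CStarAlgebra.spectralOrder B
  have _ := CStarAlgebra.spectralOrderedRing B
  simp only [← CStarAlgebra.nonneg_iff_eq_star_mul_self] at hf ⊢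
  exact Finset.sum_nonneg hf

theorem add_s3 {K L : S → S → B →L[ℂ] B} (hK : IsCPDKernel K) (hL : IsCPDKernel L) :
    IsCPDKernel (fun s s' => K s s' + L s s') := by
  intro n s a b
  have h := exists_finset_sum_eq_star_mul_self Finset.univ
    (fun k : Bool => ∑ i, ∑ j,
      star (b i) * (if k then K else L) (s i) (s j) (star (a i) * a j) * b j)
    (by rintro (_ | _) -
        · exact hL n s a b
        · exact hK n s a b)
  simpa [mul_add, add_mul, Finset.sum_add_distrib] using h

theorem elemCPD (c : S → ℝ≥0 → B) (t : ℝ≥0) : IsCPDKernel (elemCPD c t) := by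
  intro n s a b
  refine ⟨∑ i, a i * c (s i) t * b i, ?_⟩
  simp [_root_.elemCPD, star_sum, Finset.sum_mul, Finset.mul_sum, mul_assoc]
  exact Finset.sum_comm

/-- A kernel on a disjoint union which vanishes on mixed pairs is CPD if its restriction to
each summand is. -/
theorem of_blockDiagonal {A : Type*} {S : A → Type*} {K : (Σ α, S α) → (Σ α, S α) → B →L[ℂ] B}
    (hdiag : ∀ α, IsCPDKernel fun s s' : S α => K ⟨α, s⟩ ⟨α, s'⟩)
    (hoff : ∀ p q, p.1 ≠ q.1 → K p q = 0) : IsCPDKernel K := by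
  classical
  intro n s a b
  have hsum : ∑ i, ∑ j, star (b i) * K (s i) (s j) (star (a i) * a j) * b j =
      ∑ α ∈ Finset.univ.image fun i => (s i).1,
        ∑ i : {i // (s i).1 = α}, ∑ j : {j // (s j).1 = α},
          star (b i) * K (s i) (s j) (star (a i) * a j) * b j := by
    rw [← Finset.sum_fiberwise_of_maps_to (g := fun i => (s i).1)
      fun i hi => Finset.mem_image_of_mem (fun i => (s i).1) hi]
    refine Finset.sum_congr rfl fun α _ => ?_
    rw [Finset.sum_subtype (p := fun i => (s i).1 = α) _ (by simp)]
    refine Finset.sum_congr rfl fun i _ => ?_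
    rw [← Finset.sum_subtype (Finset.univ.filter fun j => (s j).1 = α) (by simp)
      fun j => star (b i) * K (s i) (s j) (star (a i) * a j) * b j]
    refine (Finset.sum_filter_of_ne fun j _ hj => ?_).symm
    by_contra hne
    exact hj (by simp [hoff (s i) (s j) fun h => hne (h ▸ i.2)])
  rw [hsum]
  refine exists_finset_sum_eq_star_mul_self _ _ fun α _ => ?_
  have hs : ∀ i : {i // (s i).1 = α}, ∃ x : S α, s i = ⟨α, x⟩ := by
    rintro ⟨i, rfl⟩
    exact ⟨_, rfl⟩
  choose x hx using hs
  simpa only [hx] using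
    (hdiag α).exists_sum_eq_star_mul_self x (fun i => a i) (fun i => b i)

end IsCPDKernel

section PowersSum

variable {A : Type*} {S : A → Type*} {B : Type*} [CStarAlgebra B]
  (T : ∀ α, ℝ≥0 → S α → S α → B →L[ℂ] B) (c : ∀ α, S α → ℝ≥0 → B) (t : ℝ≥0)

theorem powersSumFamilyCPD_same (α : A) (s s' : S α) :
    powersSumFamilyCPD T c t ⟨α, s⟩ ⟨α, s'⟩ = T α t s s' := by
  simp [powersSumFamilyCPD]

theorem powersSumFamilyCPD_of_ne {p q : Σ α, S α} (h : p.1 ≠ q.1) :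
    powersSumFamilyCPD T c t p q = elemCPD (fun p : Σ α, S α => c p.1 p.2) t p q := by
  simp [powersSumFamilyCPD, elemCPD, h]

end PowersSum

theorem elemCPD_zero {S B : Type*} [CStarAlgebra B] {c : S → ℝ≥0 → B}
    (hc : ∀ s, IsOneParamSemigroup (c s)) (s s' : S) :
    elemCPD c 0 s s' = ContinuousLinearMap.id ℂ B := by
  ext b
  simp [elemCPD, (hc s).1, (hc s').1]

theorem elemCPD_add {S B : Type*} [CStarAlgebra B] {c : S → ℝ≥0 → B}
    (hc : ∀ s, IsOneParamSemigroup (c s)) (t u : ℝ≥0) (s s' : S) :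
    elemCPD c (t + u) s s' = (elemCPD c t s s').comp (elemCPD c u s s') := by
  ext b
  simp [elemCPD, add_comm t u, (hc s).2, (hc s').2, mul_assoc]

/-- The Powers sum of an arbitrary family of spatial CPD-semigroups
(with units implemented by the norm-continuous semigroups `c α s`) is a CPD-semigroup
on the disjoint union `Σ α, S α`, the combined family of semigroups implements a unit
for it, and in particular it is spatial. -/
theorem powersSumFamilyCPD_isCPDSemigroup_and_spatial {A : Type*} {S : A → Type*} {B : Type*}
    [CStarAlgebra B]
    (T : ∀ α, ℝ≥0 → S α → S α → B →L[ℂ] B)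
    (c : ∀ α, S α → ℝ≥0 → B)
    (hT : ∀ α, IsCPDSemigroup (T α))
    (hc : ∀ α, IsUnitFor (c α) (T α)) :
    IsCPDSemigroup (powersSumFamilyCPD T c) ∧
      IsUnitFor (fun p : Σ α, S α => c p.1 p.2) (powersSumFamilyCPD T c) ∧
      IsSpatialCPDSemigroup (powersSumFamilyCPD T c) := by
  have hunit : IsUnitFor (fun p : Σ α, S α => c p.1 p.2) (powersSumFamilyCPD T c) := by
    refine ⟨fun p => (hc p.1).1 p.2, fun t => .of_blockDiagonal (fun α => ?_) fun p q h => ?_⟩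
    · simpa only [powersSumFamilyCPD_same, elemCPD] using (hc α).2 t
    · rw [powersSumFamilyCPD_of_ne T c t h, sub_self]
  have hsemi := fun p => (hunit.1 p).2
  refine ⟨⟨fun t => ?_, fun p q => ?_, fun t u p q => ?_⟩, hunit, _, hunit⟩
  · have h := (hunit.2 t).add_s3 (IsCPDKernel.elemCPD (fun p : Σ α, S α => c p.1 p.2) t)
    simp only [sub_add_cancel] at h
    exact h
  · by_cases h : p.1 = q.1
    · obtain ⟨α, s⟩ := p
      obtain ⟨β, s'⟩ := q
      obtain rfl : α = β := h
      simpa only [powersSumFamilyCPD_same] using (hT α).2.1 s s'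
    · rw [powersSumFamilyCPD_of_ne T c _ h, elemCPD_zero hsemi]
  · by_cases h : p.1 = q.1
    · obtain ⟨α, s⟩ := p
      obtain ⟨β, s'⟩ := q
      obtain rfl : α = β := h
      simpa only [powersSumFamilyCPD_same] using (hT α).2.2 t u s s'
    · simp only [powersSumFamilyCPD_of_ne T c _ h, elemCPD_add hsemi]
end

section
/- Let B be a unital C*-algebra, 𝔗 a CPD-semigroup on a set S with values in the bounded linear maps on B, and suppose 𝔗 dominates the elementary CPD-semigroup 𝔖 implemented by norm-continuous semigroups (c^s)_{s∈S} in B. Define the extended family 𝔗̂ on S₀ = S ∪ {0} (the type Option S, with 0 the added point) by 𝔗̂_t^{s,s'} := 𝔗_t^{s,s'} for s,s' ∈ S, 𝔗̂_t^{0,s'}(b) := b c^{s'}_t, 𝔗̂_t^{s,0}(b) := (c^s_t)* b, and 𝔗̂_t^{0,0} := id_B. Then 𝔗̂ is a CPD-semigroup on S₀, and it dominates the elementary CPD-semigroup on S₀ implemented by the family (c^s)_{s∈S} extended by the constant semigroup c^0_t = 1; in particular, 𝔗̂ is spatial. -/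
open scoped NNReal

/-- The extension `𝔗̂` of a CPD-semigroup `T` on `S` to `S₀ = S ∪ {0}` (modelled as
`Option S`, with `none` the added point `0`) relative to the implementing semigroups `c`:
`𝔗̂_t^{s,s'} = 𝔗_t^{s,s'}`, `𝔗̂_t^{0,s'}(b) = b c^{s'}_t`, `𝔗̂_t^{s,0}(b) = (c^s_t)* b`,
`𝔗̂_t^{0,0} = id`.  (Recall `mulLeftRight ℂ B x y b = x * b * y`.) -/
noncomputable def extendedCPD {S : Type*} {B : Type*} [CStarAlgebra B]
    (T : ℝ≥0 → S → S → B →L[ℂ] B) (c : S → ℝ≥0 → B)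
    (t : ℝ≥0) : Option S → Option S → B →L[ℂ] B :=
  fun s s' =>
    match s, s' with
    | some s, some s' => T t s s'
    | none, some s' => ContinuousLinearMap.mulLeftRight ℂ B 1 (c s' t)
    | some s, none => ContinuousLinearMap.mulLeftRight ℂ B (star (c s t)) 1
    | none, none => ContinuousLinearMap.id ℂ B

theorem CStarAlgebra.exists_star_mul_self_add {B : Type*} [CStarAlgebra B] (x y : B) :
    ∃ z : B, star x * x + star y * y = star z * z := by
  let _ := CStarAlgebra.spectralOrder B
  have _ := CStarAlgebra.spectralOrderedRing B
  exact CStarAlgebra.nonneg_iff_eq_star_mul_self.mp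
    (add_nonneg (star_mul_self_nonneg x) (star_mul_self_nonneg y))

/-- Extending a CPD-kernel by zero to an added point gives a CPD-kernel. -/
theorem IsCPDKernel.of_option {S B : Type*} [CStarAlgebra B]
    {K : Option S → Option S → B →L[ℂ] B}
    (hK : IsCPDKernel (fun s s' : S => K (some s) (some s')))
    (hleft : ∀ s, K none s = 0) (hright : ∀ s, K s none = 0) : IsCPDKernel K := by
  intro n s a b
  by_cases hs : ∃ i s₀, s i = some s₀
  · obtain ⟨-, s₀, -⟩ := hs
    obtain ⟨y, hy⟩ := hK n (fun i => (s i).getD s₀) a (fun i => (s i).elim 0 fun _ => b i)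
    refine ⟨y, hy ▸ Finset.sum_congr rfl fun i _ => Finset.sum_congr rfl fun j _ => ?_⟩
    cases hi : s i <;> cases hj : s j <;> simp [hleft, hright]
  · have hnone : ∀ i, s i = none := fun i =>
      Option.eq_none_iff_forall_ne_some.mpr fun s₀ h => hs ⟨i, s₀, h⟩
    exact ⟨0, by simp [hnone, hleft]⟩

theorem IsOneParamSemigroup.commute {B : Type*} [CStarAlgebra B] {c : ℝ≥0 → B}
    (hc : IsOneParamSemigroup c) (t u : ℝ≥0) : Commute (c t) (c u) := by
  rw [Commute, SemiconjBy, ← hc.2, ← hc.2, add_comm]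

theorem isCPDKernel_extendedCPD_sub_elemCPD {S B : Type*} [CStarAlgebra B]
    {T : ℝ≥0 → S → S → B →L[ℂ] B} {c : S → ℝ≥0 → B} (t : ℝ≥0)
    (h : IsCPDKernel (fun s s' => T t s s' - elemCPD c t s s')) :
    IsCPDKernel (fun s s' => extendedCPD T c t s s' -
      elemCPD (fun s : Option S => s.elim (fun _ => (1 : B)) c) t s s') := by
  refine IsCPDKernel.of_option h (fun s => ?_) (fun s => ?_) <;>
    cases s <;> ext b <;> simp [extendedCPD, elemCPD]

theorem IsUnitFor.extendedCPD {S B : Type*} [CStarAlgebra B]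
    {T : ℝ≥0 → S → S → B →L[ℂ] B} {c : S → ℝ≥0 → B} (hc : IsUnitFor c T) :
    IsUnitFor (fun s : Option S => s.elim (fun _ => (1 : B)) c) (extendedCPD T c) := by
  refine ⟨?_, fun t => isCPDKernel_extendedCPD_sub_elemCPD t (hc.2 t)⟩
  rintro (_ | s)
  · exact ⟨continuous_const, rfl, fun _ _ => (mul_one 1).symm⟩
  · exact hc.1 s

theorem IsUnitFor.isCPDKernel {S B : Type*} [CStarAlgebra B]
    {T : ℝ≥0 → S → S → B →L[ℂ] B} {c : S → ℝ≥0 → B} (hc : IsUnitFor c T) (t : ℝ≥0) :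
    IsCPDKernel (T t) := by
  simpa using (hc.2 t).add (isCPDKernel_elemCPD c t)

theorem IsCPDSemigroup.extendedCPD {S B : Type*} [CStarAlgebra B]
    {T : ℝ≥0 → S → S → B →L[ℂ] B} {c : S → ℝ≥0 → B}
    (hT : IsCPDSemigroup T) (hc : IsUnitFor c T) : IsCPDSemigroup (extendedCPD T c) := by
  refine ⟨hc.extendedCPD.isCPDKernel, ?_, ?_⟩
  · rintro (_ | s) (_ | s')
    · rfl
    · ext b
      simp [_root_.extendedCPD, (hc.1 s').2.1]
    · ext b
      simp [_root_.extendedCPD, (hc.1 s).2.1]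
    · exact hT.2.1 s s'
  · rintro t u (_ | s) (_ | s')
    · rfl
    · ext b
      simp [_root_.extendedCPD, (hc.1 s').2.2, ((hc.1 s').2.commute t u).eq, mul_assoc]
    · ext b
      simp [_root_.extendedCPD, (hc.1 s).2.2, ((hc.1 s).2.commute t u).eq, mul_assoc]
    · exact hT.2.2 t u s s'

/-- Let `𝔗` be a CPD-semigroup on `S` dominating the elementary
CPD-semigroup implemented by norm-continuous semigroups `c`.  Then the extended family
`𝔗̂` on `S₀ = S ∪ {0}` is a CPD-semigroup, and it dominates the elementary
CPD-semigroup implemented by `c` extended by the constant semigroup `1`; in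
particular, `𝔗̂` is spatial. -/
theorem extendedCPD_isCPDSemigroup_and_spatial {S : Type*} {B : Type*} [CStarAlgebra B]
    (T : ℝ≥0 → S → S → B →L[ℂ] B) (c : S → ℝ≥0 → B)
    (hT : IsCPDSemigroup T) (hc : IsUnitFor c T) :
    IsCPDSemigroup (extendedCPD T c) ∧
      IsUnitFor (fun s : Option S => s.elim (fun _ => (1 : B)) c) (extendedCPD T c) ∧
      IsSpatialCPDSemigroup (extendedCPD T c) := by
  exact ⟨hT.extendedCPD hc, hc.extendedCPD, _, hc.extendedCPD⟩
end

section
/- Let B be a unital C*-algebra and let 𝔗 be a strongly continuous CPD-semigroup on a set S with values in the bounded linear maps on B. If 𝔗 is spatial, then 𝔗 has a Christensen–Evans generator: for all s,s' ∈ S the limit Ω^{s,s'} := lim_{t→0+} (𝔗_t^{s,s'} − id_B)/t exists in operator norm, and there exist a completely positive definite kernel Ω₀ on S with values in the bounded linear maps on B and elements β_s ∈ B (s ∈ S) such that Ω^{s,s'}(b) = Ω₀^{s,s'}(b) + b β_{s'} + β_s* b for all b ∈ B and s,s' ∈ S. -/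
open scoped NNReal

/-- `T` has a *Christensen–Evans generator*: the derivatives
`Ω^{s,s'} = lim_{t→0⁺} (𝔗_t^{s,s'} − id)/t` exist in operator norm and decompose as
`Ω^{s,s'}(b) = Ω₀^{s,s'}(b) + b β_{s'} + β_s* b` with `Ω₀` a CPD-kernel. -/
def HasChristensenEvansGenerator {S : Type*} {B : Type*} [CStarAlgebra B]
    (T : ℝ≥0 → S → S → B →L[ℂ] B) : Prop :=
  ∃ Ω : S → S → B →L[ℂ] B,
    (∀ s s', Filter.Tendsto
        (fun t : ℝ≥0 => (((t : ℝ) : ℂ))⁻¹ • (T t s s' - ContinuousLinearMap.id ℂ B))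
        (nhdsWithin 0 (Set.Ioi 0)) (nhds (Ω s s'))) ∧
    ∃ (Ω₀ : S → S → B →L[ℂ] B) (β : S → B),
      IsCPDKernel Ω₀ ∧
      ∀ s s' (b : B), Ω s s' b = Ω₀ s s' b + b * β s' + star (β s) * b

section Semigroup

variable {A : Type*} [NormedRing A]

/-- A multiplicative one-parameter family that is norm continuous at `0` is norm continuous. -/
lemma continuous_of_semigroup_of_tendsto {f : ℝ≥0 → A}
    (hadd : ∀ t u, f (t + u) = f t * f u)
    (h0 : Filter.Tendsto f (nhds 0) (nhds 1)) : Continuous f := by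
  obtain ⟨δ, hδ, hb⟩ : ∃ δ > (0 : ℝ≥0), ∀ t < δ, ‖f t‖ ≤ ‖(1 : A)‖ + 1 := by
    have h2 : ∀ᶠ t in nhds (0 : ℝ≥0), ‖f t‖ < ‖(1 : A)‖ + 1 :=
      h0.norm.eventually_lt_const (by linarith)
    obtain ⟨δ, hδ, h⟩ := (nhds_bot_basis (α := ℝ≥0)).eventually_iff.mp h2
    exact ⟨δ, by simpa using hδ, fun t ht => (h ht).le⟩
  have hloc : ∀ (n : ℕ) (t : ℝ≥0), t < n * δ → ‖f t‖ ≤ (‖(1 : A)‖ + 1) ^ n := by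
    intro n
    induction n with
    | zero => intro t ht; simp at ht
    | succ n ih =>
      intro t ht
      by_cases hn : n = 0
      · subst hn; simpa using hb t (by simpa using ht)
      have hn' : (0 : ℝ≥0) < n := by positivity
      have hn1 : (0 : ℝ≥0) < n + 1 := by positivity
      have e : t = t / (n + 1) + n * (t / (n + 1)) := by field_simp; ring
      have hlt : t / (n + 1) < δ := by
        rw [div_lt_iff₀ hn1]; push_cast at ht; rwa [mul_comm]
      rw [e, hadd, pow_succ']
      exact (norm_mul_le _ _).trans (mul_le_mul (hb _ hlt)
        (ih _ (mul_lt_mul_of_pos_left hlt hn')) (norm_nonneg _) (by positivity))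
  rw [continuous_iff_continuousAt]
  intro t₀
  obtain ⟨n, hn⟩ := exists_nat_gt ((t₀ + 1) / δ)
  have hn' : t₀ + 1 < n * δ := by rwa [div_lt_iff₀ hδ] at hn
  set M := (‖(1 : A)‖ + 1) ^ n
  have key : ∀ r u : ℝ≥0, r < t₀ + 1 → ‖f (r + u) - f r‖ ≤ M * ‖f u - 1‖ := by
    intro r u hr
    rw [hadd, ← mul_sub_one]
    exact (norm_mul_le _ _).trans
      (mul_le_mul_of_nonneg_right (hloc n r (hr.trans hn')) (norm_nonneg _))
  have hd : Filter.Tendsto (fun t => M * ‖f (nndist t t₀) - 1‖) (nhds t₀) (nhds 0) := by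
    have h3 : Filter.Tendsto (fun t => nndist t t₀) (nhds t₀) (nhds 0) := by
      have : Continuous fun t => nndist t t₀ := by fun_prop
      simpa using this.tendsto t₀
    simpa using ((h0.comp h3).sub_const 1).norm.const_mul M
  rw [ContinuousAt, tendsto_iff_norm_sub_tendsto_zero]
  refine squeeze_zero' (Filter.Eventually.of_forall fun _ => norm_nonneg _) ?_ hd
  filter_upwards [eventually_lt_nhds (show t₀ < t₀ + 1 by simp)] with t ht
  rcases le_total t t₀ with h | h
  · have e : t₀ = t + nndist t t₀ := by
      ext; rw [NNReal.coe_add, coe_nndist, NNReal.dist_eq, abs_sub_comm, abs_of_nonneg] <;>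
      simp [h]
    have h4 := key t (nndist t t₀) ht
    rwa [← e, norm_sub_rev] at h4
  · have e : t = t₀ + nndist t t₀ := by
      ext; rw [NNReal.coe_add, coe_nndist, NNReal.dist_eq, abs_of_nonneg] <;>
      simp [h]
    have h4 := key t₀ (nndist t t₀) (by simp)
    rwa [← e] at h4

/-- A norm-continuous one-parameter semigroup in a Banach algebra has a bounded generator. -/
lemma exists_generator_of_continuous [NormedAlgebra ℂ A] [CompleteSpace A] {f : ℝ≥0 → A}
    (h1 : f 0 = 1) (hadd : ∀ t u, f (t + u) = f t * f u) (hf : Continuous f) :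
    ∃ g : A, Filter.Tendsto (fun t : ℝ≥0 => ((t : ℝ) : ℂ)⁻¹ • (f t - 1))
      (nhdsWithin 0 (Set.Ioi 0)) (nhds g) := by
  set p : ℝ → A := fun x => f x.toNNReal with hp
  have hpc : Continuous p := by fun_prop
  set F : ℝ → A := fun x => ∫ y in (0 : ℝ)..x, p y with hF
  have hFd : ∀ x, HasDerivAt F (p x) x := fun x =>
    intervalIntegral.integral_hasDerivAt_right (hpc.intervalIntegrable _ _)
      (hpc.stronglyMeasurableAtFilter _ _) hpc.continuousAt
  have hF0 : F 0 = 0 := by simp [hF]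
  have hp0 : p 0 = 1 := by simp [hp, h1]
  obtain ⟨ε, hε, hu⟩ : ∃ ε > (0 : ℝ), IsUnit (F ε) := by
    have h2 := (hFd 0).tendsto_slope_zero_right
    rw [hp0, hF0] at h2
    have h3 := h2.eventually (Units.isOpen.mem_nhds isUnit_one)
    obtain ⟨ε, h4, hε⟩ := (h3.and self_mem_nhdsWithin).exists
    refine ⟨ε, hε, ?_⟩
    have h5 : IsUnit (ε⁻¹ • F ε) := by simpa using h4
    have h6 := (IsUnit.mk0 ε (ne_of_gt hε)).map (algebraMap ℝ A) |>.mul h5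
    rwa [← Algebra.smul_def, smul_smul, mul_inv_cancel₀ (ne_of_gt hε), one_smul] at h6
  obtain ⟨u, hu⟩ := hu
  have hshift : ∀ t : ℝ≥0, f t * F ε = F (t + ε) - F t := by
    intro t
    have e1 : F (t + ε) - F t = ∫ y in (t : ℝ)..(t + ε), p y :=
      intervalIntegral.integral_interval_sub_left (hpc.intervalIntegrable _ _)
        (hpc.intervalIntegrable _ _)
    have e2 : (∫ y in (0 : ℝ)..ε, p (t + y)) = ∫ y in (t : ℝ)..(t + ε), p y := by
      simp
    have e3 : (∫ y in (0 : ℝ)..ε, p (t + y)) = ∫ y in (0 : ℝ)..ε, f t * p y := by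
      refine intervalIntegral.integral_congr fun y hy => ?_
      rw [Set.uIcc_of_le hε.le] at hy
      simp only [hp]
      rw [show ((t : ℝ) + y).toNNReal = t + y.toNNReal by
        rw [Real.toNNReal_add t.coe_nonneg hy.1, Real.toNNReal_coe], hadd]
    rw [e1, ← e2, e3]
    exact ((ContinuousLinearMap.mul ℝ A (f t)).intervalIntegral_comp_comm
      (hpc.intervalIntegrable 0 ε)).symm
  set h : ℝ → A := fun x => (F (x + ε) - F x) * ((u⁻¹ : Aˣ) : A) with hh
  have hhf : ∀ t : ℝ≥0, h t = f t := by
    intro t; rw [hh]; simp only; rw [← hshift, ← hu, mul_assoc, Units.mul_inv, mul_one]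
  have hder : HasDerivAt h ((p (0 + ε) - p 0) * ((u⁻¹ : Aˣ) : A)) 0 :=
    (((hFd (0 + ε)).comp_add_const 0 ε).sub (hFd 0)).mul_const _
  refine ⟨_, Filter.Tendsto.congr ?_ (hder.tendsto_slope_zero_right.comp
    (f := fun t : ℝ≥0 => (t : ℝ)) (x := nhdsWithin 0 (Set.Ioi 0)) ?_)⟩
  · intro t
    have h00 : h 0 = 1 := by simpa [h1] using hhf 0
    simp only [Function.comp, zero_add]
    rw [hhf, h00, ← Complex.ofReal_inv, Complex.coe_smul]
  · refine tendsto_nhdsWithin_iff.mpr ⟨?_, ?_⟩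
    · exact (NNReal.continuous_coe.tendsto 0).mono_left nhdsWithin_le_nhds
    · filter_upwards [self_mem_nhdsWithin] with t ht using ht

end Semigroup

section CPDKernel

variable {S : Type*} {B : Type*} [CStarAlgebra B]

open CStarAlgebra in
/-- The operator norm of a diagonal entry of a CPD-kernel is controlled by its value at `1`. -/
lemma IsCPDKernel.norm_apply_star_mul_self_le {K : S → S → B →L[ℂ] B} (hK : IsCPDKernel K)
    (s : S) (a : B) : ‖K s s (star a * a)‖ ≤ ‖a‖ ^ 2 * ‖K s s 1‖ := by
  let _ := spectralOrder B
  have := spectralOrderedRing B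
  have hpos : ∀ d : B, 0 ≤ K s s (star d * d) := by
    intro d
    obtain ⟨y, hy⟩ := hK 1 (fun _ => s) (fun _ => d) (fun _ => 1)
    simp at hy
    rw [hy]; exact star_mul_self_nonneg y
  have h1 : star a * a ≤ algebraMap ℝ B (‖a‖ ^ 2) := by
    have := IsSelfAdjoint.le_algebraMap_norm_self (IsSelfAdjoint.star_mul_self a)
    rwa [CStarRing.norm_star_mul_self, ← sq] at this
  obtain ⟨d, hd⟩ := nonneg_iff_eq_star_mul_self.mp (sub_nonneg.mpr h1)
  have h2 : K s s (star a * a) ≤ (‖a‖ ^ 2) • K s s 1 := by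
    have := hpos d
    rw [← hd, map_sub, Algebra.algebraMap_eq_smul_one, ← Complex.coe_smul, map_smul,
      Complex.coe_smul] at this
    exact sub_nonneg.mp this
  refine (norm_le_norm_of_nonneg_of_le (hpos a) h2).trans ?_
  rw [norm_smul]; simp

/-- CPD-kernels are hermitian. -/
lemma IsCPDKernel.apply_star {K : S → S → B →L[ℂ] B} (hK : IsCPDKernel K)
    (s s' : S) (a : B) : K s' s (star a) = star (K s s' a) := by
  set P := K s s 1
  set X := K s s' a
  set X' := K s' s (star a)
  set Q := K s' s' (star a * a)
  have hsa : ∀ c : ℂ, IsSelfAdjoint (P + c • X + (star c • X' + (star c * c) • Q)) := by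
    intro c
    obtain ⟨y, hy⟩ := hK 2 ![s, s'] ![1, a] ![1, c • 1]
    simp [Fin.sum_univ_two, smul_smul] at hy
    convert IsSelfAdjoint.star_mul_self y using 1
    rw [← hy]
    simp [P, X, X', Q, mul_comm]
  have h0 := (hsa 0).star_eq
  have h1 := (hsa 1).star_eq
  have h2 := (hsa (-1)).star_eq
  have h3 := (hsa Complex.I).star_eq
  have h4 := (hsa (-Complex.I)).star_eq
  simp at h0 h1 h2 h3 h4
  have e1 : star X + star X' = X + X' := by
    have : (2 : ℂ) • (star X + star X') = (2 : ℂ) • (X + X') := by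
      simp only [two_smul]
      linear_combination (norm := module) h1 - h2
    exact smul_right_injective B (two_ne_zero (α := ℂ)) this
  have e2 : star X' - star X = X - X' := by
    have : (2 * Complex.I) • (star X' - star X) = (2 * Complex.I) • (X - X') := by
      simp only [mul_smul, two_smul, smul_sub]
      linear_combination (norm := module) h3 - h4
    exact smul_right_injective B (by simp : (2 * Complex.I) ≠ 0) this
  have : (2 : ℂ) • X' = (2 : ℂ) • star X := by
    simp only [two_smul]
    linear_combination (norm := module) e2 - e1
  exact smul_right_injective B (two_ne_zero (α := ℂ)) this

open CStarAlgebra in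
/-- Cauchy–Schwarz inequality for CPD-kernels. -/
lemma IsCPDKernel.norm_apply_sq_le {K : S → S → B →L[ℂ] B} (hK : IsCPDKernel K)
    (s s' : S) (a : B) : ‖K s s' a‖ ^ 2 ≤ ‖K s s 1‖ * ‖K s' s' (star a * a)‖ := by
  let _ := spectralOrder B
  have := spectralOrderedRing B
  have hX' := hK.apply_star s s' a
  set P := K s s 1
  set X := K s s' a
  set X' := K s' s (star a)
  set Q := K s' s' (star a * a)
  have hr : ∀ r : ℝ, 0 ≤ r → 2 * r * ‖X‖ ^ 2 ≤ r ^ 2 * ‖P‖ * ‖X‖ ^ 2 + ‖Q‖ := by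
    intro r hr
    obtain ⟨y, hy⟩ := hK 2 ![s, s'] ![1, a] ![-(r : ℂ) • X, 1]
    have hpos : 0 ≤ star y * y := star_mul_self_nonneg y
    rw [← hy] at hpos
    have hle : ((2 * r : ℝ) : ℂ) • (star X * X)
        ≤ ((r ^ 2 : ℝ) : ℂ) • (star X * P * X) + Q := by
      rw [← sub_nonneg]
      refine hpos.trans_eq ?_
      simp [Fin.sum_univ_two, smul_smul]
      change _ + -((r : ℂ) • (star X * X)) + (-((r : ℂ) • (X' * X)) + Q) = _
      rw [hX']
      change (r * r) • (star X * P * X) + -((r : ℂ) • (star X * X)) +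
        (-((r : ℂ) • (star X * X)) + Q) = _
      simp only [sq, ← Complex.ofReal_mul, Complex.coe_smul, mul_smul, two_smul]
      abel
    have hnn : 0 ≤ ((2 * r : ℝ) : ℂ) • (star X * X) := by
      rw [Complex.coe_smul]
      exact smul_nonneg (by positivity) (star_mul_self_nonneg X)
    have hn := norm_le_norm_of_nonneg_of_le hnn hle
    rw [norm_smul, CStarRing.norm_star_mul_self, Complex.norm_real, Real.norm_of_nonneg
      (by positivity), ← sq] at hn
    refine hn.trans ((norm_add_le _ _).trans (add_le_add ?_ le_rfl))
    rw [norm_smul, Complex.norm_real, Real.norm_of_nonneg (sq_nonneg r), mul_assoc (r ^ 2)]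
    refine mul_le_mul_of_nonneg_left ?_ (by positivity)
    calc ‖star X * P * X‖ ≤ ‖star X‖ * ‖P‖ * ‖X‖ :=
          (norm_mul_le _ _).trans (mul_le_mul_of_nonneg_right (norm_mul_le _ _) (norm_nonneg _))
      _ = ‖P‖ * ‖X‖ ^ 2 := by rw [norm_star]; ring
  rcases (norm_nonneg P).eq_or_lt with h0 | h0
  · rw [← h0] at hr ⊢
    by_contra! hx
    have hx' : 0 < ‖X‖ ^ 2 := by simpa using hx
    have := hr ((‖Q‖ + 1) / ‖X‖ ^ 2) (by positivity)
    rw [mul_assoc, div_mul_cancel₀ _ hx'.ne'] at this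
    linarith [norm_nonneg Q]
  · have := hr ‖P‖⁻¹ (by positivity)
    have h5 : ‖P‖ * (2 * ‖P‖⁻¹ * ‖X‖ ^ 2) ≤ ‖P‖ * (‖P‖⁻¹ ^ 2 * ‖P‖ * ‖X‖ ^ 2 + ‖Q‖) :=
      mul_le_mul_of_nonneg_left this h0.le
    field_simp at h5
    linarith

/-- The operator norm of a CPD-kernel is controlled by its diagonal values at `1`. -/
lemma IsCPDKernel.opNorm_le {K : S → S → B →L[ℂ] B} (hK : IsCPDKernel K) (s s' : S) :
    ‖K s s'‖ ≤ √(‖K s s 1‖ * ‖K s' s' 1‖) := by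
  refine ContinuousLinearMap.opNorm_le_bound _ (Real.sqrt_nonneg _) fun a => ?_
  rw [← Real.sqrt_sq (norm_nonneg a), ← Real.sqrt_mul (by positivity)]
  refine Real.le_sqrt_of_sq_le ((hK.norm_apply_sq_le s s' a).trans ?_)
  rw [mul_assoc]
  refine mul_le_mul_of_nonneg_left ?_ (norm_nonneg _)
  rw [mul_comm]
  exact hK.norm_apply_star_mul_self_le s' a

open CStarAlgebra in
/-- CPD-kernels are closed under pointwise limits of nonnegative multiples. -/
lemma IsCPDKernel.of_tendsto_smul {ι : Type*} {l : Filter ι} [l.NeBot]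
    {K : ι → S → S → B →L[ℂ] B} {r : ι → ℝ} {L : S → S → B →L[ℂ] B}
    (hr : ∀ i, 0 ≤ r i) (hK : ∀ i, IsCPDKernel (K i))
    (h : ∀ s s' b, Filter.Tendsto (fun i => (r i : ℂ) • K i s s' b) l (nhds (L s s' b))) :
    IsCPDKernel L := by
  let _ := spectralOrder B
  have := spectralOrderedRing B
  intro n s a b
  rw [← nonneg_iff_eq_star_mul_self]
  have hlim : Filter.Tendsto (fun i => ∑ j, ∑ k, star (b j) *
      ((r i : ℂ) • K i (s j) (s k) (star (a j) * a k)) * b k) l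
      (nhds (∑ j, ∑ k, star (b j) * L (s j) (s k) (star (a j) * a k) * b k)) :=
    tendsto_finsetSum _ fun j _ => tendsto_finsetSum _ fun k _ =>
      ((h _ _ _).const_mul _).mul_const _
  refine ge_of_tendsto' hlim fun i => ?_
  obtain ⟨y, hy⟩ := hK i n s a b
  simp only [mul_smul_comm, smul_mul_assoc, ← Finset.smul_sum]
  rw [hy, Complex.coe_smul]
  exact smul_nonneg (hr i) (star_mul_self_nonneg y)

end CPDKernel

section Spatial

variable {S : Type*} {B : Type*} [CStarAlgebra B] {T : ℝ≥0 → S → S → B →L[ℂ] B}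

lemma elemCPD_apply (c : S → ℝ≥0 → B) (t : ℝ≥0) (s s' : S) (b : B) :
    elemCPD c t s s' b = star (c s t) * b * c s' t := by
  simp [elemCPD]

/-- A strongly continuous CPD-semigroup with a unit is norm continuous at `0`. -/
lemma IsUnitFor.tendsto_nhds_zero {c : S → ℝ≥0 → B} (hc : IsUnitFor c T)
    (hT0 : ∀ s s', T 0 s s' = ContinuousLinearMap.id ℂ B)
    (hstrong : ∀ (s s' : S) (b : B), Continuous fun t => T t s s' b) (s s' : S) :
    Filter.Tendsto (fun t => T t s s') (nhds 0) (nhds 1) := by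
  obtain ⟨hc, hK⟩ := hc
  have hc0 : ∀ s, c s 0 = 1 := fun s => (hc s).2.1
  have hcc : ∀ s, Continuous (c s) := fun s => (hc s).1
  have hdiag : ∀ s, Filter.Tendsto (fun t => ‖(T t s s - elemCPD c t s s) 1‖)
      (nhds 0) (nhds 0) := by
    intro s
    have hcont : Continuous fun t => ‖(T t s s - elemCPD c t s s) 1‖ := by
      simp only [sub_apply, elemCPD_apply]
      exact ((hstrong s s 1).sub
        (((hcc s).star.mul continuous_const).mul (hcc s))).norm
    have := hcont.tendsto 0
    simpa [elemCPD_apply, hT0, hc0] using this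
  have hdiff : Filter.Tendsto (fun t => T t s s' - elemCPD c t s s') (nhds 0) (nhds 0) := by
    rw [tendsto_zero_iff_norm_tendsto_zero]
    have hle : ∀ t, ‖T t s s' - elemCPD c t s s'‖ ≤ √(‖(T t s s - elemCPD c t s s) 1‖ *
        ‖(T t s' s' - elemCPD c t s' s') 1‖) := fun t => (hK t).opNorm_le s s'
    refine squeeze_zero (fun _ => norm_nonneg _) hle ?_
    have h := ((hdiag s).mul (hdiag s')).sqrt
    rwa [mul_zero, Real.sqrt_zero] at h
  have helem : Filter.Tendsto (fun t => elemCPD c t s s') (nhds 0) (nhds 1) := by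
    have hcont : Continuous fun t => elemCPD c t s s' :=
      ((ContinuousLinearMap.mulLeftRight ℂ B).continuous.comp (hcc s).star).clm_apply (hcc s')
    have h0 : elemCPD c 0 s s' = 1 := by ext b; simp [elemCPD_apply, hc0]
    simpa [h0] using hcont.tendsto 0
  simpa using hdiff.add helem

/-- The generator of an elementary CPD-semigroup. -/
lemma tendsto_elemCPD_generator {c : S → ℝ≥0 → B} {γ : S → B} (hc : ∀ s, Continuous (c s))
    (hc0 : ∀ s, c s 0 = 1)
    (hγ : ∀ s, Filter.Tendsto (fun t : ℝ≥0 => ((t : ℝ) : ℂ)⁻¹ • (c s t - 1))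
      (nhdsWithin 0 (Set.Ioi 0)) (nhds (γ s))) (s s' : S) (b : B) :
    Filter.Tendsto (fun t : ℝ≥0 => ((t : ℝ) : ℂ)⁻¹ • (elemCPD c t s s' b - b))
      (nhdsWithin 0 (Set.Ioi 0)) (nhds (b * γ s' + star (γ s) * b)) := by
  have h1 : Filter.Tendsto (c s') (nhdsWithin 0 (Set.Ioi 0)) (nhds 1) := by
    rw [← hc0 s']; exact ((hc s').tendsto 0).mono_left nhdsWithin_le_nhds
  have h2 := ((hγ s').const_mul b).add (((hγ s).star.mul_const b).mul h1)
  rw [mul_one] at h2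
  refine h2.congr fun t => ?_
  rw [elemCPD_apply]
  simp only [star_smul, ← Complex.ofReal_inv, RCLike.star_def, Complex.conj_ofReal, star_sub,
    star_one, mul_smul_comm, smul_mul_assoc, ← smul_add]
  congr 1
  noncomm_ring

end Spatial

/-- A strongly continuous spatial CPD-semigroup on a unital C*-algebra
has a Christensen–Evans generator. -/
theorem spatial_CPDSemigroup_hasChristensenEvansGenerator
    {S : Type*} {B : Type*} [CStarAlgebra B]
    (T : ℝ≥0 → S → S → B →L[ℂ] B)
    (hT : IsCPDSemigroup T)
    (hstrong : ∀ (s s' : S) (b : B), Continuous fun t => T t s s' b)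
    (hspatial : IsSpatialCPDSemigroup T) :
    HasChristensenEvansGenerator T := by
  obtain ⟨c, hc⟩ := hspatial
  obtain ⟨-, hT0, hTadd⟩ := hT
  have hlim := hc.tendsto_nhds_zero hT0 hstrong
  obtain ⟨hcs, hK⟩ := hc
  have hΩ : ∀ s s', ∃ g : B →L[ℂ] B, Filter.Tendsto
      (fun t : ℝ≥0 => ((t : ℝ) : ℂ)⁻¹ • (T t s s' - 1))
      (nhdsWithin 0 (Set.Ioi 0)) (nhds g) := fun s s' =>
    exists_generator_of_continuous (hT0 s s') (fun t u => hTadd t u s s')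
      (continuous_of_semigroup_of_tendsto (fun t u => hTadd t u s s') (hlim s s'))
  choose Ω hΩ using hΩ
  have hγ := fun s => exists_generator_of_continuous (hcs s).2.1 (hcs s).2.2 (hcs s).1
  choose γ hγ using hγ
  refine ⟨Ω, hΩ, fun s s' => Ω s s' - ((ContinuousLinearMap.mul ℂ B).flip (γ s')
    + ContinuousLinearMap.mul ℂ B (star (γ s))), γ, ?_, fun s s' b => ?_⟩
  · refine IsCPDKernel.of_tendsto_smul (l := nhdsWithin (0 : ℝ≥0) (Set.Ioi 0))
      (r := fun t => (t : ℝ)⁻¹) (fun t => by positivity) hK fun s s' b => ?_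
    have h1 := ((ContinuousLinearMap.apply ℂ B b).continuous.tendsto _).comp (hΩ s s')
    have h2 := tendsto_elemCPD_generator (fun s => (hcs s).1) (fun s => (hcs s).2.1) hγ s s' b
    refine (h1.sub h2).congr fun t => ?_
    simp [← smul_sub]
  · simp [add_assoc]
end

section
/- Let B be a unital C*-algebra and for i = 1,2 let T^i = (T^i_t)_{t≥0} be a Schur CP-semigroup on M_{n_i}(B) (each T^i_t acts entrywise, is completely positive, T^i_0 = id, T^i_{t+u} = T^i_t ∘ T^i_u), which is spatial with unit implemented by a norm-continuous semigroup (C^i_t)_{t≥0} of diagonal matrices in M_{n_i}(B) (C^i_0 = 1, C^i_{t+u} = C^i_t C^i_u, and A ↦ T^i_t(A) − (C^i_t)* A C^i_t completely positive for all t). Identify M_{n_1+n_2}(B) with 2×2 block matrices over the blocks of sizes n_1, n_2, and define (T^1 ⊞ T^2)_t by sending the block matrix with blocks A_{11}, A_{12}, A_{21}, A_{22} to the block matrix with blocks T^1_t(A_{11}), (C^1_t)* A_{12} C^2_t, (C^2_t)* A_{21} C^1_t, T^2_t(A_{22}). Then T^1 ⊞ T^2 is a Schur CP-semigroup on M_{n_1+n_2}(B),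 and with C_t := diag(C^1_t, C^2_t) the map A ↦ (T^1 ⊞ T^2)_t(A) − C_t* A C_t is completely positive for every t ≥ 0; in particular, T^1 ⊞ T^2 is spatial. -/
open scoped NNReal

/-- A map `T` on a unital *-algebra `A` is *completely positive* if all finite sums
`∑_{k,l} Cₖ* T(Aₖ* Aₗ) Cₗ` are positive, i.e. of the form `Y* Y`. -/
def IsCPMap {A : Type*} [Ring A] [StarRing A] (T : A → A) : Prop :=
  ∀ (m : ℕ) (a c : Fin m → A),
    ∃ y : A, ∑ k, ∑ l, star (c k) * T (star (a k) * a l) * c l = star y * y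

/-- `T` is a *Schur map* on matrices over `B`: it acts entrywise via a kernel of
bounded linear maps on `B`. -/
def IsSchurMap {ι : Type*} {B : Type*} [CStarAlgebra B]
    (T : Matrix ι ι B → Matrix ι ι B) : Prop :=
  ∃ K : ι → ι → B →L[ℂ] B, ∀ A i j, T A i j = K i j (A i j)

/-- The Powers sum `T¹ ⊞ T²` of two Schur CP-semigroups on `M_{n₁}(B)` and `M_{n₂}(B)`
(with respect to implementing diagonal semigroups `C₁`, `C₂`), acting on
`M_{n₁+n₂}(B)` identified with `2×2` block matrices. -/
noncomputable def blockPowersSum {n₁ n₂ : ℕ} {B : Type*} [CStarAlgebra B]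
    (T₁ : ℝ≥0 → Matrix (Fin n₁) (Fin n₁) B → Matrix (Fin n₁) (Fin n₁) B)
    (T₂ : ℝ≥0 → Matrix (Fin n₂) (Fin n₂) B → Matrix (Fin n₂) (Fin n₂) B)
    (C₁ : ℝ≥0 → Matrix (Fin n₁) (Fin n₁) B)
    (C₂ : ℝ≥0 → Matrix (Fin n₂) (Fin n₂) B)
    (t : ℝ≥0)
    (A : Matrix (Fin n₁ ⊕ Fin n₂) (Fin n₁ ⊕ Fin n₂) B) :
    Matrix (Fin n₁ ⊕ Fin n₂) (Fin n₁ ⊕ Fin n₂) B :=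
  Matrix.fromBlocks (T₁ t A.toBlocks₁₁) (star (C₁ t) * A.toBlocks₁₂ * C₂ t)
    (star (C₂ t) * A.toBlocks₂₁ * C₁ t) (T₂ t A.toBlocks₂₂)

open Matrix

/-- A selfadjoint element of a C⋆-algebra has a compression (by its negative part) which is the
negative of a positive element, and which vanishes only if the element itself is positive. -/
theorem IsSelfAdjoint.exists_compression_eq_neg_star_mul_self {A : Type*} [CStarAlgebra A] {a : A}
    (ha : IsSelfAdjoint a) :
    ∃ z w : A, star z * a * z = -(star w * w) ∧
      (star w * w = 0 → ∃ y : A, a = star y * y) := by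
  let _ := CStarAlgebra.spectralOrder A
  have _ := CStarAlgebra.spectralOrderedRing A
  obtain ⟨s, hs⟩ := CStarAlgebra.nonneg_iff_eq_star_mul_self.1 (CFC.negPart_nonneg a)
  have hneg : star a⁻ = a⁻ := (IsSelfAdjoint.of_nonneg (CFC.negPart_nonneg a)).star_eq
  have hw : star (s * a⁻) * (s * a⁻) = a⁻ * a⁻ * a⁻ := by
    conv_rhs => enter [1, 2]; rw [hs]
    simp only [star_mul, hneg, mul_assoc]
  have hcube : star a⁻ * a * a⁻ = -(a⁻ * a⁻ * a⁻) := by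
    conv_lhs => rw [hneg]; enter [1, 2]; rw [← CFC.posPart_sub_negPart a ha]
    simp [mul_sub]
  refine ⟨a⁻, s * a⁻, by rw [hw, hcube], fun h ↦ ?_⟩
  rw [hw] at h
  have hsq : star (a⁻ * a⁻) * (a⁻ * a⁻) = 0 := by
    rw [star_mul, hneg, ← mul_assoc, h, zero_mul]
  rw [CStarRing.star_mul_self_eq_zero_iff] at hsq
  have hzero : a⁻ = 0 := CStarRing.star_mul_self_eq_zero_iff _ |>.1 (by rw [hneg, hsq])
  exact CStarAlgebra.nonneg_iff_eq_star_mul_self.1 ((CFC.negPart_eq_zero_iff a ha).1 hzero)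

section QuadraticForm

variable {ι B : Type*} [Fintype ι] [DecidableEq ι] [CStarAlgebra B]

/-- A matrix over a C⋆-algebra is determined by its quadratic form on column vectors. -/
theorem Matrix.eq_zero_of_forall_star_dotProduct_mulVec_eq_zero {D : Matrix ι ι B}
    (h : ∀ x : ι → B, star x ⬝ᵥ D *ᵥ x = 0) : D = 0 := by
  have polar (x y : ι → B) : star x ⬝ᵥ D *ᵥ y = 0 := by
    have h₁ := h (x + y)
    have h₂ := h (x + Complex.I • y)
    simp only [star_add, star_smul, mulVec_add, mulVec_smul, add_dotProduct, dotProduct_add,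
      smul_dotProduct, dotProduct_smul, h, smul_zero, zero_add, add_zero, RCLike.star_def,
      Complex.conj_I] at h₁ h₂
    rw [neg_smul, neg_add_eq_zero, smul_right_inj Complex.I_ne_zero] at h₂
    rw [h₂, ← two_smul ℂ] at h₁
    exact (smul_eq_zero_iff_right two_ne_zero).1 h₁
  ext i j
  simpa [← Pi.single_star] using polar (Pi.single i 1) (Pi.single j 1)

/-- A matrix over a C⋆-algebra whose quadratic form on column vectors is nonnegative
is positive. -/
theorem Matrix.exists_eq_star_mul_self_of_forall_star_dotProduct_mulVec_nonneg
    [PartialOrder B] [StarOrderedRing B] {M : Matrix ι ι B}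
    (h : ∀ x : ι → B, 0 ≤ star x ⬝ᵥ M *ᵥ x) : ∃ y : Matrix ι ι B, M = star y * y := by
  have form_conj (D z : Matrix ι ι B) (x : ι → B) :
      star x ⬝ᵥ (star z * D * z) *ᵥ x = star (z *ᵥ x) ⬝ᵥ D *ᵥ (z *ᵥ x) := by
    rw [star_mulVec, ← mulVec_mulVec, ← mulVec_mulVec, ← dotProduct_mulVec, star_eq_conjTranspose]
  have hM : IsSelfAdjoint M := by
    refine sub_eq_zero.1 (Matrix.eq_zero_of_forall_star_dotProduct_mulVec_eq_zero fun x ↦ ?_)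
    have := (IsSelfAdjoint.of_nonneg (h x)).star_eq
    rw [sub_mulVec, dotProduct_sub, star_eq_conjTranspose, sub_eq_zero]
    rw [← this]
    rw [star_dotProduct, star_mulVec, conjTranspose_conjTranspose, ← dotProduct_mulVec]
  obtain ⟨z, w, hzw, hpos⟩ : ∃ z w : Matrix ι ι B, star z * M * z = -(star w * w) ∧
      (star w * w = 0 → ∃ y, M = star y * y) :=
    IsSelfAdjoint.exists_compression_eq_neg_star_mul_self (A := CStarMatrix ι ι B) hM
  refine hpos (Matrix.eq_zero_of_forall_star_dotProduct_mulVec_eq_zero fun x ↦ le_antisymm ?_ ?_)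
  · have := h (z *ᵥ x)
    rwa [← form_conj, hzw, neg_mulVec, dotProduct_neg, Left.nonneg_neg_iff] at this
  · have := form_conj 1 w x
    rw [mul_one, one_mulVec] at this
    rw [this]
    exact Finset.sum_nonneg fun i _ ↦ star_mul_self_nonneg _

end QuadraticForm

section PositiveKernel

variable {ι κ B : Type*} [Fintype ι] [Fintype κ] [CStarAlgebra B]

theorem Matrix.star_dotProduct_mulVec_eq_sum (M : Matrix ι ι B) (u v : ι → B) :
    star u ⬝ᵥ M *ᵥ v = ∑ i, ∑ j, star (u i) * M i j * v j := by
  simp only [dotProduct, mulVec, Finset.mul_sum, Pi.star_apply, mul_assoc]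

variable [PartialOrder B]

/-- A kernel `K` of bounded maps on `B` is *positive* if all sums
`∑ₖₗᵢⱼ star (xₖ i) * K i j (star (aₖ i) * aₗ j) * xₗ j` are nonnegative. -/
def IsPositiveKernel (K : Matrix ι ι (B →L[ℂ] B)) : Prop :=
  ∀ (m : ℕ) (a x : Fin m → ι → B),
    0 ≤ ∑ k, ∑ l, ∑ i, ∑ j, star (x k i) * K i j (star (a k i) * a l j) * x l j

variable [StarOrderedRing B]

theorem IsPositiveKernel.add {K L : Matrix ι ι (B →L[ℂ] B)} (hK : IsPositiveKernel K)
    (hL : IsPositiveKernel L) : IsPositiveKernel (K + L) := fun m a x ↦ by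
  simpa only [Matrix.add_apply, _root_.add_apply, mul_add, add_mul,
    Finset.sum_add_distrib] using add_nonneg (hK m a x) (hL m a x)

theorem isPositiveKernel_mulLeftRight (d : ι → B) :
    IsPositiveKernel (Matrix.of fun i j ↦
      ContinuousLinearMap.mulLeftRight ℂ B (star (d i)) (d j)) := fun m a x ↦ by
  convert star_mul_self_nonneg (∑ k, ∑ i, a k i * d i * x k i) using 1
  simp only [star_sum, Finset.sum_mul_sum, of_apply, ContinuousLinearMap.mulLeftRight_apply,
    star_mul, mul_assoc]

theorem IsPositiveKernel.fromBlocks_zero {K : Matrix ι ι (B →L[ℂ] B)}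
    {L : Matrix κ κ (B →L[ℂ] B)} (hK : IsPositiveKernel K) (hL : IsPositiveKernel L) :
    IsPositiveKernel (Matrix.fromBlocks K 0 0 L) := fun m a x ↦ by
  have := add_nonneg (hK m (fun k ↦ a k ∘ Sum.inl) fun k ↦ x k ∘ Sum.inl)
    (hL m (fun k ↦ a k ∘ Sum.inr) fun k ↦ x k ∘ Sum.inr)
  simpa [Fintype.sum_sum_type, Finset.sum_add_distrib] using this

variable [DecidableEq ι]

/-- A Schur map is completely positive if and only if its kernel is positive. -/
theorem isCPMap_iff_isPositiveKernel {T : Matrix ι ι B → Matrix ι ι B}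
    {K : Matrix ι ι (B →L[ℂ] B)} (hT : ∀ A i j, T A i j = K i j (A i j)) :
    IsCPMap T ↔ IsPositiveKernel K := by
  refine ⟨fun h m a x ↦ ?_, fun h m a c ↦ ?_⟩
  · rcases isEmpty_or_nonempty ι with _ | ⟨⟨i₀⟩⟩
    · simp
    obtain ⟨y, hy⟩ := h m (fun k ↦ Matrix.of fun p j ↦ if p = i₀ then a k j else 0)
      (fun k ↦ Matrix.of fun i p ↦ if p = i₀ then x k i else 0)
    have hy₀ := congr_fun₂ hy i₀ i₀
    simp only [Matrix.sum_apply, Matrix.mul_apply, star_apply, hT, of_apply, Finset.sum_mul,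
      if_true] at hy₀
    have h_nonneg : 0 ≤ ∑ p, star (y p i₀) * y p i₀ :=
      Finset.sum_nonneg fun p _ ↦ star_mul_self_nonneg _
    rw [← hy₀] at h_nonneg
    convert h_nonneg using 3 with k _ l _
    rw [Finset.sum_comm]
    simp [apply_ite star, ite_mul]
  · refine Matrix.exists_eq_star_mul_self_of_forall_star_dotProduct_mulVec_nonneg fun v ↦ ?_
    convert Finset.sum_nonneg fun p (_ : p ∈ Finset.univ) ↦
      h m (fun k ↦ a k p) (fun k ↦ c k *ᵥ v) using 1
    have (k l : Fin m) : star v ⬝ᵥ (star (c k) * T (star (a k) * a l) * c l) *ᵥ v =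
        ∑ p, ∑ i, ∑ j, star ((c k *ᵥ v) i) * K i j (star (a k p i) * a l p j) *
          (c l *ᵥ v) j := by
      rw [← mulVec_mulVec, ← mulVec_mulVec, dotProduct_mulVec, star_eq_conjTranspose,
        ← star_mulVec, Matrix.star_dotProduct_mulVec_eq_sum]
      simp only [hT, Matrix.mul_apply, star_apply, map_sum, Finset.mul_sum, Finset.sum_mul]
      rw [Finset.sum_comm_cycle]
    simp only [sum_mulVec, dotProduct_sum, this]
    rw [Finset.sum_comm_cycle]

end PositiveKernel

/-- Conjugation by diagonal matrices acts entrywise. -/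
theorem Matrix.star_diagonal_mul_mul_diagonal_apply {m n B : Type*} [Fintype m] [Fintype n]
    [DecidableEq m] [DecidableEq n] [Ring B] [StarRing B] (d : m → B) (e : n → B)
    (A : Matrix m n B) (i : m) (j : n) :
    (star (Matrix.diagonal d) * A * Matrix.diagonal e) i j = star (d i) * A i j * e j := by
  rw [mul_diagonal, star_eq_conjTranspose, diagonal_conjTranspose, diagonal_mul, Pi.star_apply]

section BlockPowersSum

variable {n₁ n₂ : ℕ} {B : Type*} [CStarAlgebra B]
  {T₁ : ℝ≥0 → Matrix (Fin n₁) (Fin n₁) B → Matrix (Fin n₁) (Fin n₁) B}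
  {T₂ : ℝ≥0 → Matrix (Fin n₂) (Fin n₂) B → Matrix (Fin n₂) (Fin n₂) B}
  {C₁ : ℝ≥0 → Matrix (Fin n₁) (Fin n₁) B} {C₂ : ℝ≥0 → Matrix (Fin n₂) (Fin n₂) B} {t : ℝ≥0}
  {d₁ : Fin n₁ → B} {d₂ : Fin n₂ → B}

/-- If the implementing matrices are diagonal, the Powers sum minus the conjugation by
their block sum is the block diagonal sum of the differences of the summands. -/
theorem blockPowersSum_sub_conj_apply {K₁ : Matrix (Fin n₁) (Fin n₁) (B →L[ℂ] B)}
    {K₂ : Matrix (Fin n₂) (Fin n₂) (B →L[ℂ] B)}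
    (hK₁ : ∀ A i j, T₁ t A i j - (star (C₁ t) * A * C₁ t) i j = K₁ i j (A i j))
    (hK₂ : ∀ A i j, T₂ t A i j - (star (C₂ t) * A * C₂ t) i j = K₂ i j (A i j))
    (hd₁ : C₁ t = Matrix.diagonal d₁) (hd₂ : C₂ t = Matrix.diagonal d₂)
    (A : Matrix (Fin n₁ ⊕ Fin n₂) (Fin n₁ ⊕ Fin n₂) B) (i j : Fin n₁ ⊕ Fin n₂) :
    blockPowersSum T₁ T₂ C₁ C₂ t A i j -
        star (Sum.elim d₁ d₂ i) * A i j * Sum.elim d₁ d₂ j =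
      Matrix.fromBlocks K₁ 0 0 K₂ i j (A i j) := by
  rcases i with i | i <;> rcases j with j | j
  · have := hK₁ A.toBlocks₁₁ i j
    rw [hd₁, Matrix.star_diagonal_mul_mul_diagonal_apply] at this
    simpa [blockPowersSum, toBlocks₁₁] using this
  · simp [-mul_diagonal, blockPowersSum, hd₁, hd₂,
      Matrix.star_diagonal_mul_mul_diagonal_apply, toBlocks₁₂]
  · simp [-mul_diagonal, blockPowersSum, hd₁, hd₂,
      Matrix.star_diagonal_mul_mul_diagonal_apply, toBlocks₂₁]
  · have := hK₂ A.toBlocks₂₂ i j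
    rw [hd₂, Matrix.star_diagonal_mul_mul_diagonal_apply] at this
    simpa [blockPowersSum, toBlocks₂₂] using this

/-- A Schur map minus the conjugation by a diagonal matrix is a Schur map. -/
theorem IsSchurMap.exists_kernel_sub_conj {ι : Type*} [Fintype ι] [DecidableEq ι]
    {T : Matrix ι ι B → Matrix ι ι B} (hT : IsSchurMap T) {C : Matrix ι ι B} {d : ι → B}
    (hd : C = Matrix.diagonal d) :
    ∃ K : Matrix ι ι (B →L[ℂ] B), ∀ A i j, T A i j - (star C * A * C) i j = K i j (A i j) := by
  obtain ⟨K, hK⟩ := hT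
  refine ⟨Matrix.of fun i j ↦
    K i j - ContinuousLinearMap.mulLeftRight ℂ B (star (d i)) (d j), fun A i j ↦ ?_⟩
  simp [-mul_diagonal, hK, hd, Matrix.star_diagonal_mul_mul_diagonal_apply]

end BlockPowersSum

/-- The Powers sum `T¹ ⊞ T²` of two spatial Schur CP-semigroups on
`M_{n₁}(B)` and `M_{n₂}(B)` with units implemented by norm-continuous semigroups of
diagonal matrices `C₁`, `C₂` is a Schur CP-semigroup on `M_{n₁+n₂}(B)`, and with
`C_t = diag(C¹_t, C²_t)` the maps `A ↦ (T¹ ⊞ T²)_t(A) − C_t* A C_t` are completely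
positive; in particular, `T¹ ⊞ T²` is spatial. -/
theorem blockPowersSum_isSchurCPSemigroup_and_spatial {n₁ n₂ : ℕ} {B : Type*}
    [CStarAlgebra B]
    (T₁ : ℝ≥0 → Matrix (Fin n₁) (Fin n₁) B → Matrix (Fin n₁) (Fin n₁) B)
    (T₂ : ℝ≥0 → Matrix (Fin n₂) (Fin n₂) B → Matrix (Fin n₂) (Fin n₂) B)
    (C₁ : ℝ≥0 → Matrix (Fin n₁) (Fin n₁) B)
    (C₂ : ℝ≥0 → Matrix (Fin n₂) (Fin n₂) B)
    (hS₁ : ∀ t, IsSchurMap (T₁ t)) (hS₂ : ∀ t, IsSchurMap (T₂ t))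
    (hCP₁ : ∀ t, IsCPMap (T₁ t)) (hCP₂ : ∀ t, IsCPMap (T₂ t))
    (h0₁ : T₁ 0 = id) (h0₂ : T₂ 0 = id)
    (hsg₁ : ∀ t u, T₁ (t + u) = T₁ t ∘ T₁ u) (hsg₂ : ∀ t u, T₂ (t + u) = T₂ t ∘ T₂ u)
    (hCcont₁ : Continuous C₁) (hCcont₂ : Continuous C₂)
    (hC0₁ : C₁ 0 = 1) (hC0₂ : C₂ 0 = 1)
    (hCsg₁ : ∀ t u, C₁ (t + u) = C₁ t * C₁ u) (hCsg₂ : ∀ t u, C₂ (t + u) = C₂ t * C₂ u)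
    (hCdiag₁ : ∀ t, ∃ d : Fin n₁ → B, C₁ t = Matrix.diagonal d)
    (hCdiag₂ : ∀ t, ∃ d : Fin n₂ → B, C₂ t = Matrix.diagonal d)
    (hdom₁ : ∀ t, IsCPMap (fun A => T₁ t A - star (C₁ t) * A * C₁ t))
    (hdom₂ : ∀ t, IsCPMap (fun A => T₂ t A - star (C₂ t) * A * C₂ t)) :
    (∀ t, IsSchurMap (blockPowersSum T₁ T₂ C₁ C₂ t)) ∧
    (∀ t, IsCPMap (blockPowersSum T₁ T₂ C₁ C₂ t)) ∧
    blockPowersSum T₁ T₂ C₁ C₂ 0 = id ∧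
    (∀ t u, blockPowersSum T₁ T₂ C₁ C₂ (t + u) =
      blockPowersSum T₁ T₂ C₁ C₂ t ∘ blockPowersSum T₁ T₂ C₁ C₂ u) ∧
    (let C : ℝ≥0 → Matrix (Fin n₁ ⊕ Fin n₂) (Fin n₁ ⊕ Fin n₂) B :=
        fun t => Matrix.fromBlocks (C₁ t) 0 0 (C₂ t);
      Continuous C ∧ C 0 = 1 ∧ (∀ t u, C (t + u) = C t * C u) ∧
      (∀ t, ∃ d : Fin n₁ ⊕ Fin n₂ → B, C t = Matrix.diagonal d) ∧
      (∀ t, IsCPMap (fun A => blockPowersSum T₁ T₂ C₁ C₂ t A - star (C t) * A * C t))) := by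
  let _ := CStarAlgebra.spectralOrder B
  have _ := CStarAlgebra.spectralOrderedRing B
  have kernel (t : ℝ≥0) : ∃ (K : Matrix (Fin n₁ ⊕ Fin n₂) (Fin n₁ ⊕ Fin n₂) (B →L[ℂ] B))
      (d : Fin n₁ ⊕ Fin n₂ → B),
      Matrix.fromBlocks (C₁ t) 0 0 (C₂ t) = Matrix.diagonal d ∧
      (∀ A i j, blockPowersSum T₁ T₂ C₁ C₂ t A i j -
        star (d i) * A i j * d j = K i j (A i j)) ∧
      IsPositiveKernel K := by
    obtain ⟨d₁, hd₁⟩ := hCdiag₁ t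
    obtain ⟨d₂, hd₂⟩ := hCdiag₂ t
    obtain ⟨K₁, hK₁⟩ := (hS₁ t).exists_kernel_sub_conj hd₁
    obtain ⟨K₂, hK₂⟩ := (hS₂ t).exists_kernel_sub_conj hd₂
    exact ⟨Matrix.fromBlocks K₁ 0 0 K₂, Sum.elim d₁ d₂,
      by rw [hd₁, hd₂, fromBlocks_diagonal],
      blockPowersSum_sub_conj_apply hK₁ hK₂ hd₁ hd₂,
      ((isCPMap_iff_isPositiveKernel hK₁).1 (hdom₁ t)).fromBlocks_zero
        ((isCPMap_iff_isPositiveKernel hK₂).1 (hdom₂ t))⟩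
  have kernel_sum (t : ℝ≥0) : ∃ K : Matrix (Fin n₁ ⊕ Fin n₂) (Fin n₁ ⊕ Fin n₂) (B →L[ℂ] B),
      (∀ A i j, blockPowersSum T₁ T₂ C₁ C₂ t A i j = K i j (A i j)) ∧ IsPositiveKernel K := by
    obtain ⟨K, d, -, hK, hpos⟩ := kernel t
    refine ⟨_, fun A i j ↦ ?_, hpos.add (isPositiveKernel_mulLeftRight d)⟩
    simp [← hK]
  refine ⟨fun t ↦ ?_, fun t ↦ ?_, ?_, fun t u ↦ ?_, ?_, ?_, fun t u ↦ ?_, fun t ↦ ?_, fun t ↦ ?_⟩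
  · obtain ⟨K, hK, -⟩ := kernel_sum t
    exact ⟨K, hK⟩
  · obtain ⟨K, hK, hpos⟩ := kernel_sum t
    exact (isCPMap_iff_isPositiveKernel hK).2 hpos
  · funext A
    simp [blockPowersSum, h0₁, h0₂, hC0₁, hC0₂, fromBlocks_toBlocks]
  · funext A
    simp only [blockPowersSum, Function.comp_apply, toBlocks_fromBlocks₁₁, toBlocks_fromBlocks₁₂,
      toBlocks_fromBlocks₂₁, toBlocks_fromBlocks₂₂, hsg₁, hsg₂]
    rw [add_comm t u, hCsg₁, hCsg₂]
    simp only [star_mul, Matrix.mul_assoc]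
  · exact hCcont₁.matrix_fromBlocks continuous_const continuous_const hCcont₂
  · simp [hC0₁, hC0₂]
  · simp [hCsg₁, hCsg₂, fromBlocks_multiply]
  · obtain ⟨K, d, hd, -⟩ := kernel t
    exact ⟨d, hd⟩
  · obtain ⟨K, d, hd, hK, hpos⟩ := kernel t
    refine (isCPMap_iff_isPositiveKernel fun A i j ↦ ?_).2 hpos
    beta_reduce
    rw [← hK, hd, Matrix.sub_apply, Matrix.star_diagonal_mul_mul_diagonal_apply]
end

section
/- For i = 1,2 let H_i be a complex Hilbert space, let T^i = (T^i_t)_{t≥0} be a CP-semigroup on B(H_i) (each T^i_t : B(H_i) → B(H_i) is a completely positive bounded linear map, T^i_0 = id, T^i_{t+u} = T^i_t ∘ T^i_u), and let c^i : [0,∞) → B(H_i) be a semigroup (c^i_0 = 1, c^i_{t+u} = c^i_t c^i_u) such that a ↦ T^i_t(a) − (c^i_t)* a c^i_t is completely positive for every t ≥ 0. Let H = H_1 ⊕ H_2 (Hilbert space direct sum), with isometric inclusions ι_k : H_k → H and projections p_k = ι_k* : H → H_k, and for a ∈ B(H) write a_{kl} := p_k ∘ a ∘ ι_l ∈ B(H_l,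 H_k). Define (T^1 ⊞ T^2)_t(a) := ι_1 ∘ T^1_t(a_{11}) ∘ p_1 + ι_1 ∘ ((c^1_t)* ∘ a_{12} ∘ c^2_t) ∘ p_2 + ι_2 ∘ ((c^2_t)* ∘ a_{21} ∘ c^1_t) ∘ p_1 + ι_2 ∘ T^2_t(a_{22}) ∘ p_2. Then T^1 ⊞ T^2 is a CP-semigroup on B(H), and with C_t := ι_1 ∘ c^1_t ∘ p_1 + ι_2 ∘ c^2_t ∘ p_2 (a semigroup in B(H)), the map a ↦ (T^1 ⊞ T^2)_t(a) − C_t* a C_t is completely positive for every t ≥ 0; in particular, T^1 ⊞ T^2 is spatial with unit implemented by C. -/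
open scoped NNReal
open ContinuousLinearMap

/-- A map `T` on `B(H)` is *completely positive* if `∑_{k,l} bₖ* T(aₖ* aₗ) bₗ ≥ 0`
(as an operator on the Hilbert space `H`) for all finite families `aₖ, bₖ ∈ B(H)`. -/
def IsCPonBH {H : Type*} [NormedAddCommGroup H] [InnerProductSpace ℂ H] [CompleteSpace H]
    (T : (H →L[ℂ] H) → (H →L[ℂ] H)) : Prop :=
  ∀ (m : ℕ) (a b : Fin m → H →L[ℂ] H),
    (∑ k, ∑ l, star (b k) * T (star (a k) * a l) * b l).IsPositive

variable {H₁ H₂ : Type*}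
  [NormedAddCommGroup H₁] [InnerProductSpace ℂ H₁] [CompleteSpace H₁]
  [NormedAddCommGroup H₂] [InnerProductSpace ℂ H₂] [CompleteSpace H₂]

/-- The isometric inclusion `ι₁ : H₁ → H₁ ⊕ H₂`. -/
noncomputable def incl₁ : H₁ →L[ℂ] WithLp 2 (H₁ × H₂) :=
  (↑(WithLp.prodContinuousLinearEquiv 2 ℂ H₁ H₂).symm :
      H₁ × H₂ →L[ℂ] WithLp 2 (H₁ × H₂)).comp (ContinuousLinearMap.inl ℂ H₁ H₂)

/-- The isometric inclusion `ι₂ : H₂ → H₁ ⊕ H₂`. -/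
noncomputable def incl₂ : H₂ →L[ℂ] WithLp 2 (H₁ × H₂) :=
  (↑(WithLp.prodContinuousLinearEquiv 2 ℂ H₁ H₂).symm :
      H₁ × H₂ →L[ℂ] WithLp 2 (H₁ × H₂)).comp (ContinuousLinearMap.inr ℂ H₁ H₂)

/-- The projection `p₁ = ι₁* : H₁ ⊕ H₂ → H₁`. -/
noncomputable def proj₁ : WithLp 2 (H₁ × H₂) →L[ℂ] H₁ :=
  ContinuousLinearMap.adjoint (incl₁ (H₁ := H₁) (H₂ := H₂))

/-- The projection `p₂ = ι₂* : H₁ ⊕ H₂ → H₂`. -/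
noncomputable def proj₂ : WithLp 2 (H₁ × H₂) →L[ℂ] H₂ :=
  ContinuousLinearMap.adjoint (incl₂ (H₁ := H₁) (H₂ := H₂))

/-- The Powers sum `(T¹ ⊞ T²)_t` of two CP-semigroups on `B(H₁)`, `B(H₂)` with respect
to implementing semigroups `c₁`, `c₂`, acting on `B(H₁ ⊕ H₂)` blockwise:
`a ↦ ι₁ T¹_t(a₁₁) p₁ + ι₁ ((c¹_t)* a₁₂ c²_t) p₂ + ι₂ ((c²_t)* a₂₁ c¹_t) p₁ + ι₂ T²_t(a₂₂) p₂`,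
where `a_{kl} = p_k ∘ a ∘ ι_l`. -/
noncomputable def powersSumBH
    (T₁ : ℝ≥0 → (H₁ →L[ℂ] H₁) →L[ℂ] (H₁ →L[ℂ] H₁))
    (T₂ : ℝ≥0 → (H₂ →L[ℂ] H₂) →L[ℂ] (H₂ →L[ℂ] H₂))
    (c₁ : ℝ≥0 → H₁ →L[ℂ] H₁) (c₂ : ℝ≥0 → H₂ →L[ℂ] H₂)
    (t : ℝ≥0) (a : WithLp 2 (H₁ × H₂) →L[ℂ] WithLp 2 (H₁ × H₂)) :
    WithLp 2 (H₁ × H₂) →L[ℂ] WithLp 2 (H₁ × H₂) :=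
  incl₁ ∘L (T₁ t (proj₁ ∘L a ∘L incl₁)) ∘L proj₁
    + incl₁ ∘L (star (c₁ t) ∘L (proj₁ ∘L a ∘L incl₂) ∘L c₂ t) ∘L proj₂
    + incl₂ ∘L (star (c₂ t) ∘L (proj₂ ∘L a ∘L incl₁) ∘L c₁ t) ∘L proj₁
    + incl₂ ∘L (T₂ t (proj₂ ∘L a ∘L incl₂)) ∘L proj₂

section CompletelyPositive

open scoped ComplexOrder

variable {H K : Type*}
  [NormedAddCommGroup H] [InnerProductSpace ℂ H] [CompleteSpace H]
  [NormedAddCommGroup K] [InnerProductSpace ℂ K] [CompleteSpace K]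

theorem ContinuousLinearMap.IsPositive.exists_eq_star_mul_self {A : H →L[ℂ] H}
    (hA : A.IsPositive) : ∃ S, A = star S * S :=
  CStarAlgebra.nonneg_iff_eq_star_mul_self.mp ((nonneg_iff_isPositive A).mpr hA)

/-- A Gram matrix `(yₖ* yₗ)` of operators `H → K` is of the form `S* S` with `S` a matrix over
`B(H)`, also when `K` is larger than `H`. -/
theorem exists_adjoint_comp_eq_sum_star_mul {n : ℕ} (y : Fin n → H →L[ℂ] K) :
    ∃ s : Fin n → Fin n → H →L[ℂ] H,
      ∀ k l, adjoint (y k) ∘L y l = ∑ j, star (s j k) * s j l := by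
  let E := PiLp 2 fun _ : Fin n => H
  let P : Fin n → E →L[ℂ] H := fun j => PiLp.proj 2 (fun _ : Fin n => H) j
  let I : Fin n → H →L[ℂ] E := fun j =>
    (↑(PiLp.continuousLinearEquiv 2 ℂ fun _ : Fin n => H).symm :
      (Fin n → H) →L[ℂ] E) ∘L ContinuousLinearMap.single ℂ (fun _ : Fin n => H) j
  let Y : E →L[ℂ] K := ∑ j, y j ∘L P j
  have hY : ∀ k x, Y (I k x) = y k x := by
    intro k x
    have hP : ∀ j, P j (I k x) = (Pi.single k x : Fin n → H) j := fun j => rfl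
    simp only [Y, _root_.sum_apply, ContinuousLinearMap.comp_apply, hP]
    rw [Finset.sum_eq_single k]
    · simp
    · intro j _ hj
      simp [hj]
    · simp
  obtain ⟨S, hS⟩ := (isPositive_adjoint_comp_self Y).exists_eq_star_mul_self
  refine ⟨fun j k => P j ∘L S ∘L I k, fun k l => ?_⟩
  ext x
  refine ext_inner_left ℂ fun z => ?_
  have h : inner ℂ (I k z) ((adjoint Y ∘L Y) (I l x)) = inner ℂ (I k z) ((star S * S) (I l x)) := by
    rw [hS]
  simp only [ContinuousLinearMap.comp_apply, mul_def, star_eq_adjoint, adjoint_inner_right, hY,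
    _root_.sum_apply, inner_sum] at h ⊢
  rw [h, PiLp.inner_apply]
  rfl

/-- For a completely positive linear `T` on `B(H)`, the inequality `∑ ⟪hₖ, T(yₖ* yₗ) hₗ⟫ ≥ 0`
holds for operators `yₖ` from `H` into any Hilbert space. -/
theorem IsCPonBH.sum_inner_nonneg {T : (H →L[ℂ] H) →ₗ[ℂ] (H →L[ℂ] H)} (hT : IsCPonBH T)
    {n : ℕ} (y : Fin n → H →L[ℂ] K) (h : Fin n → H) :
    0 ≤ ∑ k, ∑ l, inner ℂ (h k) (T (adjoint (y k) ∘L y l) (h l)) := by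
  rcases subsingleton_or_nontrivial H with _ | _
  · have : ∀ k, h k = 0 := fun k => Subsingleton.elim _ _
    simp [this]
  obtain ⟨e, he⟩ := exists_norm_eq H (zero_le_one' ℝ)
  obtain ⟨s, hs⟩ := exists_adjoint_comp_eq_sum_star_mul y
  have key : ∀ j, 0 ≤ ∑ k, ∑ l, inner ℂ (h k) (T (star (s j k) * s j l) (h l)) := by
    intro j
    have := (hT n (s j) fun k => InnerProductSpace.rankOne ℂ (h k) e).inner_nonneg_right e
    simpa [_root_.sum_apply, inner_sum, star_eq_adjoint, adjoint_inner_right,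
      inner_self_eq_norm_sq_to_K, he, mul_def] using this
  calc 0 ≤ ∑ j, ∑ k, ∑ l, inner ℂ (h k) (T (star (s j k) * s j l) (h l)) :=
        Finset.sum_nonneg fun j _ => key j
    _ = _ := by
      rw [Finset.sum_comm]
      refine Finset.sum_congr rfl fun k _ => ?_
      rw [Finset.sum_comm]
      refine Finset.sum_congr rfl fun l _ => ?_
      rw [hs, map_sum, _root_.sum_apply, inner_sum]

theorem isPositive_of_forall_inner_nonneg {E : Type*} [NormedAddCommGroup E]
    [InnerProductSpace ℂ E] {A : E →L[ℂ] E} (h : ∀ x, 0 ≤ inner ℂ x (A x)) :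
    A.IsPositive := by
  rw [isPositive_iff_complex]
  intro x
  have h' : 0 ≤ inner ℂ (A x) x := by
    rw [← inner_conj_symm]
    exact star_nonneg_iff.mpr (h x)
  obtain ⟨hre, him⟩ := Complex.nonneg_iff.mp h'
  exact ⟨Complex.ext (by simp) (by simpa using him), hre⟩

theorem IsCPonBH.conj {T : (H →L[ℂ] H) →ₗ[ℂ] (H →L[ℂ] H)} (hT : IsCPonBH T) (V : H →L[ℂ] K) :
    IsCPonBH fun a : K →L[ℂ] K => V ∘L T (adjoint V ∘L a ∘L V) ∘L adjoint V := by
  intro n a b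
  refine isPositive_of_forall_inner_nonneg fun x => ?_
  have := hT.sum_inner_nonneg (fun k => a k ∘L V) fun k => adjoint V (b k x)
  simpa [_root_.sum_apply, inner_sum, star_eq_adjoint, adjoint_inner_right, mul_def, adjoint_comp,
    adjoint_inner_left, ContinuousLinearMap.comp_assoc] using this

theorem IsCPonBH.add {S T : (H →L[ℂ] H) → (H →L[ℂ] H)} (hS : IsCPonBH S) (hT : IsCPonBH T) :
    IsCPonBH fun a => S a + T a := by
  intro n a b
  simpa [mul_add, add_mul, Finset.sum_add_distrib] using (hS n a b).add (hT n a b)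

theorem isCPonBH_star_mul_mul (C : H →L[ℂ] H) : IsCPonBH fun a => star C * a * C := by
  intro n a b
  have : ∑ k, ∑ l, star (b k) * (star C * (star (a k) * a l) * C) * b l
      = star (∑ k, a k * C * b k) * ∑ l, a l * C * b l := by
    simp only [star_sum, star_mul, Finset.sum_mul, Finset.mul_sum, mul_assoc]
    exact Finset.sum_comm
  rw [this]
  exact isPositive_adjoint_comp_self _

end CompletelyPositive

theorem exists_clm_eq_comp_comp {E F G G' : Type*}
    [AddCommGroup E] [Module ℂ E] [TopologicalSpace E] [IsTopologicalAddGroup E]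
    [ContinuousConstSMul ℂ E]
    [AddCommGroup F] [Module ℂ F] [TopologicalSpace F] [IsTopologicalAddGroup F]
    [ContinuousConstSMul ℂ F]
    [AddCommGroup G] [Module ℂ G] [TopologicalSpace G] [IsTopologicalAddGroup G]
    [ContinuousConstSMul ℂ G]
    [AddCommGroup G'] [Module ℂ G'] [TopologicalSpace G'] [IsTopologicalAddGroup G']
    [ContinuousConstSMul ℂ G']
    (A : F →L[ℂ] G') (B : G →L[ℂ] E) :
    ∃ L : (E →L[ℂ] F) →L[ℂ] (G →L[ℂ] G'), ∀ a, L a = A ∘L a ∘L B :=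
  ⟨postcomp G A ∘L precomp F B, fun _ => rfl⟩

section DirectSum

theorem proj₁_apply (x : WithLp 2 (H₁ × H₂)) : proj₁ x = x.fst :=
  ext_inner_left ℂ fun z => by
    rw [proj₁, adjoint_inner_right]
    simp [incl₁]

theorem proj₂_apply (x : WithLp 2 (H₁ × H₂)) : proj₂ x = x.snd :=
  ext_inner_left ℂ fun z => by
    rw [proj₂, adjoint_inner_right]
    simp [incl₂]

@[simp] theorem proj₁_incl₁ (x : H₁) : proj₁ (incl₁ (H₂ := H₂) x) = x := by
  simp [proj₁_apply, incl₁]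

@[simp] theorem proj₁_incl₂ (x : H₂) : proj₁ (incl₂ (H₁ := H₁) x) = 0 := by
  simp [proj₁_apply, incl₂]

@[simp] theorem proj₂_incl₁ (x : H₁) : proj₂ (incl₁ (H₂ := H₂) x) = 0 := by
  simp [proj₂_apply, incl₁]

@[simp] theorem proj₂_incl₂ (x : H₂) : proj₂ (incl₂ (H₁ := H₁) x) = x := by
  simp [proj₂_apply, incl₂]

theorem incl_proj_add (x : WithLp 2 (H₁ × H₂)) : incl₁ (proj₁ x) + incl₂ (proj₂ x) = x := by
  rw [proj₁_apply, proj₂_apply]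
  exact WithLp.ofLp_injective 2 (by ext <;> simp [incl₁, incl₂])

theorem ext_proj {x y : WithLp 2 (H₁ × H₂)} (h₁ : proj₁ x = proj₁ y) (h₂ : proj₂ x = proj₂ y) :
    x = y := by
  rw [← incl_proj_add x, ← incl_proj_add y, h₁, h₂]

variable (T₁ : ℝ≥0 → (H₁ →L[ℂ] H₁) →L[ℂ] (H₁ →L[ℂ] H₁))
  (T₂ : ℝ≥0 → (H₂ →L[ℂ] H₂) →L[ℂ] (H₂ →L[ℂ] H₂))
  (c₁ : ℝ≥0 → H₁ →L[ℂ] H₁) (c₂ : ℝ≥0 → H₂ →L[ℂ] H₂)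
  (t u : ℝ≥0) (a : WithLp 2 (H₁ × H₂) →L[ℂ] WithLp 2 (H₁ × H₂))

theorem proj₁_comp_powersSumBH_comp_incl₁ :
    proj₁ ∘L powersSumBH T₁ T₂ c₁ c₂ t a ∘L incl₁ = T₁ t (proj₁ ∘L a ∘L incl₁) := by
  ext x; simp [powersSumBH]

theorem proj₁_comp_powersSumBH_comp_incl₂ :
    proj₁ ∘L powersSumBH T₁ T₂ c₁ c₂ t a ∘L incl₂
      = star (c₁ t) ∘L (proj₁ ∘L a ∘L incl₂) ∘L c₂ t := by
  ext x; simp [powersSumBH]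

theorem proj₂_comp_powersSumBH_comp_incl₁ :
    proj₂ ∘L powersSumBH T₁ T₂ c₁ c₂ t a ∘L incl₁
      = star (c₂ t) ∘L (proj₂ ∘L a ∘L incl₁) ∘L c₁ t := by
  ext x; simp [powersSumBH]

theorem proj₂_comp_powersSumBH_comp_incl₂ :
    proj₂ ∘L powersSumBH T₁ T₂ c₁ c₂ t a ∘L incl₂ = T₂ t (proj₂ ∘L a ∘L incl₂) := by
  ext x; simp [powersSumBH]

theorem powersSumBH_zero (h0₁ : T₁ 0 = ContinuousLinearMap.id ℂ _)
    (h0₂ : T₂ 0 = ContinuousLinearMap.id ℂ _) (hc0₁ : c₁ 0 = 1) (hc0₂ : c₂ 0 = 1) :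
    powersSumBH T₁ T₂ c₁ c₂ 0 a = a := by
  ext1 x
  have hx : a x = a (incl₁ (proj₁ x)) + a (incl₂ (proj₂ x)) := by
    rw [← map_add, incl_proj_add]
  rw [hx]
  apply ext_proj <;> simp [powersSumBH, h0₁, h0₂, hc0₁, hc0₂]

theorem powersSumBH_add
    (hsg₁ : ∀ t u, T₁ (t + u) = (T₁ t).comp (T₁ u))
    (hsg₂ : ∀ t u, T₂ (t + u) = (T₂ t).comp (T₂ u))
    (hcsg₁ : ∀ t u, c₁ (t + u) = c₁ t * c₁ u) (hcsg₂ : ∀ t u, c₂ (t + u) = c₂ t * c₂ u) :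
    powersSumBH T₁ T₂ c₁ c₂ (t + u) a
      = powersSumBH T₁ T₂ c₁ c₂ t (powersSumBH T₁ T₂ c₁ c₂ u a) := by
  conv_rhs => rw [powersSumBH]
  rw [proj₁_comp_powersSumBH_comp_incl₁, proj₁_comp_powersSumBH_comp_incl₂,
    proj₂_comp_powersSumBH_comp_incl₁, proj₂_comp_powersSumBH_comp_incl₂, powersSumBH, hsg₁, hsg₂,
    add_comm t u, hcsg₁, hcsg₂, star_mul, star_mul]
  simp only [mul_def, ContinuousLinearMap.comp_assoc, ContinuousLinearMap.comp_apply]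

theorem exists_clm_eq_powersSumBH :
    ∃ L : (WithLp 2 (H₁ × H₂) →L[ℂ] WithLp 2 (H₁ × H₂)) →L[ℂ]
        (WithLp 2 (H₁ × H₂) →L[ℂ] WithLp 2 (H₁ × H₂)),
      ∀ a, L a = powersSumBH T₁ T₂ c₁ c₂ t a := by
  obtain ⟨L₁₁, h₁₁⟩ := exists_clm_eq_comp_comp
    (proj₁ (H₁ := H₁) (H₂ := H₂)) (incl₁ (H₁ := H₁) (H₂ := H₂))
  obtain ⟨L₂₂, h₂₂⟩ := exists_clm_eq_comp_comp
    (proj₂ (H₁ := H₁) (H₂ := H₂)) (incl₂ (H₁ := H₁) (H₂ := H₂))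
  obtain ⟨M₁₁, k₁₁⟩ := exists_clm_eq_comp_comp
    (incl₁ (H₁ := H₁) (H₂ := H₂)) (proj₁ (H₁ := H₁) (H₂ := H₂))
  obtain ⟨M₂₂, k₂₂⟩ := exists_clm_eq_comp_comp
    (incl₂ (H₁ := H₁) (H₂ := H₂)) (proj₂ (H₁ := H₁) (H₂ := H₂))
  obtain ⟨L₁₂, h₁₂⟩ := exists_clm_eq_comp_comp
    (incl₁ (H₂ := H₂) ∘L star (c₁ t) ∘L proj₁ (H₂ := H₂)) (incl₂ (H₁ := H₁) ∘L c₂ t ∘L proj₂ (H₁ := H₁))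
  obtain ⟨L₂₁, h₂₁⟩ := exists_clm_eq_comp_comp
    (incl₂ (H₁ := H₁) ∘L star (c₂ t) ∘L proj₂ (H₁ := H₁)) (incl₁ (H₂ := H₂) ∘L c₁ t ∘L proj₁ (H₂ := H₂))
  refine ⟨M₁₁ ∘L T₁ t ∘L L₁₁ + L₁₂ + L₂₁ + M₂₂ ∘L T₂ t ∘L L₂₂, fun a => ?_⟩
  simp only [add_apply, ContinuousLinearMap.comp_apply, h₁₁, h₂₂, k₁₁, k₂₂, h₁₂, h₂₁, powersSumBH,
    ContinuousLinearMap.comp_assoc]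

theorem powersSumBH_sub :
    powersSumBH T₁ T₂ c₁ c₂ t a
        - star (incl₁ ∘L c₁ t ∘L proj₁ + incl₂ ∘L c₂ t ∘L proj₂) * a
          * (incl₁ ∘L c₁ t ∘L proj₁ + incl₂ ∘L c₂ t ∘L proj₂)
      = incl₁ ∘L (T₁ t (proj₁ ∘L a ∘L incl₁)
          - star (c₁ t) * (proj₁ ∘L a ∘L incl₁) * c₁ t) ∘L proj₁
        + incl₂ ∘L (T₂ t (proj₂ ∘L a ∘L incl₂)
          - star (c₂ t) * (proj₂ ∘L a ∘L incl₂) * c₂ t) ∘L proj₂ := by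
  have h : star (incl₁ ∘L c₁ t ∘L proj₁ + incl₂ ∘L c₂ t ∘L proj₂)
      = incl₁ ∘L star (c₁ t) ∘L proj₁ (H₂ := H₂) + incl₂ ∘L star (c₂ t) ∘L proj₂ (H₁ := H₁) := by
    simp [star_eq_adjoint, adjoint_comp, proj₁, proj₂, ContinuousLinearMap.comp_assoc]
  rw [h]
  ext1 x
  simp only [powersSumBH, mul_def, ContinuousLinearMap.comp_apply, add_apply, sub_apply, map_add,
    map_sub]
  abel

theorem isCPonBH_powersSumBH_sub
    (hdom₁ : IsCPonBH fun a => T₁ t a - star (c₁ t) * a * c₁ t)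
    (hdom₂ : IsCPonBH fun a => T₂ t a - star (c₂ t) * a * c₂ t) :
    IsCPonBH fun a => powersSumBH T₁ T₂ c₁ c₂ t a
      - star (incl₁ ∘L c₁ t ∘L proj₁ + incl₂ ∘L c₂ t ∘L proj₂) * a
        * (incl₁ ∘L c₁ t ∘L proj₁ + incl₂ ∘L c₂ t ∘L proj₂) := by
  simp only [powersSumBH_sub]
  refine IsCPonBH.add ?_ ?_
  · have h := IsCPonBH.conj (T := (T₁ t).toLinearMap
      - LinearMap.mulLeftRight ℂ (star (c₁ t), c₁ t)) hdom₁ (incl₁ (H₂ := H₂))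
    simpa [proj₁] using h
  · have h := IsCPonBH.conj (T := (T₂ t).toLinearMap
      - LinearMap.mulLeftRight ℂ (star (c₂ t), c₂ t)) hdom₂ (incl₂ (H₁ := H₁))
    simpa [proj₂] using h

theorem isCPonBH_powersSumBH
    (hdom₁ : IsCPonBH fun a => T₁ t a - star (c₁ t) * a * c₁ t)
    (hdom₂ : IsCPonBH fun a => T₂ t a - star (c₂ t) * a * c₂ t) :
    IsCPonBH (powersSumBH T₁ T₂ c₁ c₂ t) := by
  have h := (isCPonBH_powersSumBH_sub T₁ T₂ c₁ c₂ t hdom₁ hdom₂).add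
    (isCPonBH_star_mul_mul (incl₁ ∘L c₁ t ∘L proj₁ + incl₂ ∘L c₂ t ∘L proj₂))
  simp only [sub_add_cancel] at h
  exact h

end DirectSum

/-- For spatial CP-semigroups `T¹`, `T²` on `B(H₁)`, `B(H₂)` with units
implemented by semigroups `c₁`, `c₂`, the Powers sum `T¹ ⊞ T²` is a CP-semigroup on
`B(H₁ ⊕ H₂)` (bounded linear, completely positive, identity at `0`, semigroup law), and
with `C_t = ι₁ c¹_t p₁ + ι₂ c²_t p₂` (a semigroup in `B(H₁ ⊕ H₂)`) each map
`a ↦ (T¹ ⊞ T²)_t(a) − C_t* a C_t` is completely positive; in particular `T¹ ⊞ T²` is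
spatial with unit implemented by `C`. -/
theorem powersSumBH_isCPSemigroup_and_spatial
    (T₁ : ℝ≥0 → (H₁ →L[ℂ] H₁) →L[ℂ] (H₁ →L[ℂ] H₁))
    (T₂ : ℝ≥0 → (H₂ →L[ℂ] H₂) →L[ℂ] (H₂ →L[ℂ] H₂))
    (c₁ : ℝ≥0 → H₁ →L[ℂ] H₁) (c₂ : ℝ≥0 → H₂ →L[ℂ] H₂)
    (hCP₁ : ∀ t, IsCPonBH (T₁ t)) (hCP₂ : ∀ t, IsCPonBH (T₂ t))
    (h0₁ : T₁ 0 = ContinuousLinearMap.id ℂ _) (h0₂ : T₂ 0 = ContinuousLinearMap.id ℂ _)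
    (hsg₁ : ∀ t u, T₁ (t + u) = (T₁ t).comp (T₁ u))
    (hsg₂ : ∀ t u, T₂ (t + u) = (T₂ t).comp (T₂ u))
    (hc0₁ : c₁ 0 = 1) (hc0₂ : c₂ 0 = 1)
    (hcsg₁ : ∀ t u, c₁ (t + u) = c₁ t * c₁ u) (hcsg₂ : ∀ t u, c₂ (t + u) = c₂ t * c₂ u)
    (hdom₁ : ∀ t, IsCPonBH fun a => T₁ t a - star (c₁ t) * a * c₁ t)
    (hdom₂ : ∀ t, IsCPonBH fun a => T₂ t a - star (c₂ t) * a * c₂ t) :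
    (∀ t, ∃ L : (WithLp 2 (H₁ × H₂) →L[ℂ] WithLp 2 (H₁ × H₂)) →L[ℂ]
        (WithLp 2 (H₁ × H₂) →L[ℂ] WithLp 2 (H₁ × H₂)),
        ∀ a, L a = powersSumBH T₁ T₂ c₁ c₂ t a) ∧
    (∀ t, IsCPonBH (powersSumBH T₁ T₂ c₁ c₂ t)) ∧
    (∀ a, powersSumBH T₁ T₂ c₁ c₂ 0 a = a) ∧
    (∀ t u a, powersSumBH T₁ T₂ c₁ c₂ (t + u) a
        = powersSumBH T₁ T₂ c₁ c₂ t (powersSumBH T₁ T₂ c₁ c₂ u a)) ∧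
    (let C : ℝ≥0 → WithLp 2 (H₁ × H₂) →L[ℂ] WithLp 2 (H₁ × H₂) :=
        fun t => incl₁ ∘L c₁ t ∘L proj₁ + incl₂ ∘L c₂ t ∘L proj₂;
      C 0 = 1 ∧ (∀ t u, C (t + u) = C t * C u) ∧
      ∀ t, IsCPonBH fun a => powersSumBH T₁ T₂ c₁ c₂ t a - star (C t) * a * C t) := by
  refine ⟨fun t => exists_clm_eq_powersSumBH T₁ T₂ c₁ c₂ t,
    fun t => isCPonBH_powersSumBH T₁ T₂ c₁ c₂ t (hdom₁ t) (hdom₂ t),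
    fun a => powersSumBH_zero T₁ T₂ c₁ c₂ a h0₁ h0₂ hc0₁ hc0₂,
    fun t u a => powersSumBH_add T₁ T₂ c₁ c₂ t u a hsg₁ hsg₂ hcsg₁ hcsg₂, ?_, fun t u => ?_,
    fun t => isCPonBH_powersSumBH_sub T₁ T₂ c₁ c₂ t (hdom₁ t) (hdom₂ t)⟩
  · ext1 x
    simp [hc0₁, hc0₂, incl_proj_add]
  · ext1 x
    simp [hcsg₁, hcsg₂]
end

section
/- Let S be a set, H = ℓ²(S) the Hilbert space of square-summable complex families with standard orthonormal basis (e_s)_{s∈S}, and P_s ∈ B(H) the orthogonal projection onto ℂe_s. Let T : B(H) → B(H) be a completely positive bounded linear map which is a Schur map, i.e., T(P_s A P_{s'}) = P_s T(A) P_{s'} for all A ∈ B(H) and s, s' ∈ S. Then T maps compact operators to compact operators. -/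
open scoped ComplexOrder

noncomputable section

variable (S : Type*) [DecidableEq S]

/-- The Hilbert space `ℓ²(S)` of square-summable complex families on `S`. -/
abbrev L2 := lp (fun _ : S => ℂ) 2

variable {S}

/-- The standard orthonormal basis vector `e_s` of `ℓ²(S)`. -/
def stdONB (s : S) : L2 S := lp.single 2 s 1

/-- The rank-one operator `|e_s⟩⟨e_{s'}| : x ↦ ⟨e_{s'}, x⟩ e_s` on `ℓ²(S)`. -/
def rankOneStd (s s' : S) : L2 S →L[ℂ] L2 S :=
  (ContinuousLinearMap.toSpanSingleton ℂ (stdONB s)).comp (innerSL ℂ (stdONB s'))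

/-- The orthogonal projection `P_s` onto `ℂ e_s`. -/
def projStd (s : S) : L2 S →L[ℂ] L2 S := rankOneStd s s

/-- A map on `B(ℓ²(S))` is *completely positive* if `∑_{k,l} bₖ* T(aₖ* aₗ) bₗ ≥ 0`
(as an operator) for all finite families `aₖ, bₖ`. -/
def IsCPonL2 (T : (L2 S →L[ℂ] L2 S) → (L2 S →L[ℂ] L2 S)) : Prop :=
  ∀ (m : ℕ) (a b : Fin m → L2 S →L[ℂ] L2 S),
    (∑ k, ∑ l, star (b k) * T (star (a k) * a l) * b l).IsPositive

/-- A map on `B(ℓ²(S))` is a *Schur map* with respect to the standard basis if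
`T (P_s A P_{s'}) = P_s T(A) P_{s'}` for all `A` and `s, s'`. -/
def IsSchurOnL2 (T : (L2 S →L[ℂ] L2 S) → (L2 S →L[ℂ] L2 S)) : Prop :=
  ∀ (A : L2 S →L[ℂ] L2 S) (s s' : S),
    T (projStd s * A * projStd s') = projStd s * T A * projStd s'

end

open Filter Topology Metric

lemma projStd_apply {S : Type*} [DecidableEq S] (s : S) (x : L2 S) :
    projStd s x = lp.single 2 s (x s) := by
  simp [projStd, rankOneStd, stdONB, lp.inner_single_left, ← lp.single_smul]

lemma hasSum_projStd_apply {S : Type*} [DecidableEq S] (x : L2 S) :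
    HasSum (fun s => projStd s x) x := by
  simpa only [projStd_apply] using lp.hasSum_single ENNReal.ofNat_ne_top x

lemma norm_sum_projStd_apply_le {S : Type*} [DecidableEq S] (F : Finset S) (x : L2 S) :
    ‖(∑ s ∈ F, projStd s) x‖ ≤ ‖x‖ := by
  have hp : 0 < (2 : ENNReal).toReal := by norm_num
  rw [sum_apply, ← Real.rpow_le_rpow_iff (norm_nonneg _) (norm_nonneg _) hp]
  simp only [projStd_apply]
  rw [lp.norm_sum_single hp (fun s => x s) F]
  exact lp.sum_rpow_le_norm_rpow hp x F

lemma isCompactOperator_projStd {S : Type*} [DecidableEq S] (s : S) :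
    IsCompactOperator (projStd s) :=
  (isCompactOperator_of_locallyCompactSpace_rng
    (ContinuousLinearMap.toSpanSingleton ℂ (stdONB s))).comp_clm (innerSL ℂ (stdONB s))

lemma projStd_mul {S : Type*} [DecidableEq S] (s : S) (A : L2 S →L[ℂ] L2 S) :
    projStd s * A = (ContinuousLinearMap.toSpanSingleton ℂ (stdONB s)).comp
      (innerSL ℂ (ContinuousLinearMap.adjoint A (stdONB s))) := by
  ext1 x
  simp [projStd, rankOneStd, ContinuousLinearMap.adjoint_inner_left]

lemma adjoint_projStd {S : Type*} [DecidableEq S] (s : S) :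
    ContinuousLinearMap.adjoint (projStd s) = projStd s := by
  refine ((ContinuousLinearMap.eq_adjoint_iff _ _).2 fun x y => ?_).symm
  simp [projStd, rankOneStd, inner_smul_left, inner_smul_right, mul_comm]

/-- The row `P_s A` is the norm-convergent sum of its entries. -/
lemma hasSum_projStd_mul_mul_projStd {S : Type*} [DecidableEq S] (s : S)
    (A : L2 S →L[ℂ] L2 S) :
    HasSum (fun s' => projStd s * A * projStd s') (projStd s * A) := by
  have h := hasSum_projStd_apply (ContinuousLinearMap.adjoint A (stdONB s))
  have h' := (ContinuousLinearMap.compL ℂ (L2 S) ℂ (L2 S)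
    (ContinuousLinearMap.toSpanSingleton ℂ (stdONB s))).hasSum ((innerSL ℂ).hasSum h)
  convert h' using 1
  swap
  · exact projStd_mul s A
  funext s'
  rw [mul_assoc, projStd_mul, ContinuousLinearMap.mul_def,
    ContinuousLinearMap.adjoint_comp, adjoint_projStd]
  rfl

/-- Composing a compact operator with contractions converging strongly to the identity gives
convergence in norm. -/
lemma IsCompactOperator.tendsto_mul_of_norm_apply_le {ι E : Type*} [NormedAddCommGroup E]
    [NormedSpace ℂ E] {l : Filter ι} {P : ι → E →L[ℂ] E} (hP : ∀ i x, ‖P i x‖ ≤ ‖x‖)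
    (hlim : ∀ x, Tendsto (fun i => P i x) l (𝓝 x)) {A : E →L[ℂ] E} (hA : IsCompactOperator A) :
    Tendsto (fun i => P i * A) l (𝓝 A) := by
  rw [Metric.tendsto_nhds]
  intro ε hε
  have hK : IsCompact (closure (A '' closedBall 0 1)) :=
    IsCompactOperator.isCompact_closure_image_closedBall (f := A.toLinearMap) hA 1
  obtain ⟨t, ht, hcover⟩ := Metric.totallyBounded_iff.1 hK.totallyBounded (ε / 4) (by positivity)
  have hev : ∀ᶠ i in l, ∀ y ∈ t, dist (P i y) y < ε / 4 :=
    (eventually_all_finite ht).2 fun y _ => Metric.tendsto_nhds.1 (hlim y) _ (by positivity)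
  filter_upwards [hev] with i hi
  rw [dist_eq_norm]
  refine lt_of_le_of_lt (b := 3 * (ε / 4)) ?_ (by linarith)
  refine ContinuousLinearMap.opNorm_le_of_unit_norm (by positivity) fun x hx => ?_
  have hmem : A x ∈ closure (A '' closedBall 0 1) :=
    subset_closure ⟨x, by simp [hx], rfl⟩
  obtain ⟨y, hy, hxy⟩ := Set.mem_iUnion₂.1 (hcover hmem)
  rw [mem_ball, dist_eq_norm] at hxy
  have hPy := hi y hy
  rw [dist_eq_norm] at hPy
  calc ‖(P i * A - A) x‖ = ‖P i (A x - y) + (P i y - y) - (A x - y)‖ := by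
        congr 1
        simp
    _ ≤ ‖P i (A x - y)‖ + ‖P i y - y‖ + ‖A x - y‖ :=
        (norm_sub_le _ _).trans (by gcongr; exact norm_add_le _ _)
    _ ≤ 3 * (ε / 4) := by linarith [hP i (A x - y)]

lemma IsCompactOperator.hasSum_projStd_mul {S : Type*} [DecidableEq S] {A : L2 S →L[ℂ] L2 S}
    (hA : IsCompactOperator A) : HasSum (fun s => projStd s * A) A := by
  have h := hA.tendsto_mul_of_norm_apply_le (l := atTop) norm_sum_projStd_apply_le fun x => by
    simpa [HasSum] using hasSum_projStd_apply x
  simpa only [HasSum, Finset.sum_mul, SummationFilter.unconditional_filter] using h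

lemma HasSum.isCompactOperator {ι E : Type*} [NormedAddCommGroup E] [NormedSpace ℂ E]
    [CompleteSpace E] {f : ι → E →L[ℂ] E} {A : E →L[ℂ] E} (h : HasSum f A)
    (hf : ∀ i, IsCompactOperator (f i)) : IsCompactOperator A :=
  isCompactOperator_of_tendsto h <| Eventually.of_forall fun _ =>
    (compactOperator (RingHom.id ℂ) E E).sum_mem fun i _ => hf i

/-- A completely positive bounded linear Schur map on `B(ℓ²(S))`
maps compact operators to compact operators. -/
theorem schur_cp_map_preserves_compact {S : Type*} [DecidableEq S]
    (T : (L2 S →L[ℂ] L2 S) →L[ℂ] (L2 S →L[ℂ] L2 S))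
    (hCP : IsCPonL2 (T : (L2 S →L[ℂ] L2 S) → (L2 S →L[ℂ] L2 S)))
    (hSchur : IsSchurOnL2 (T : (L2 S →L[ℂ] L2 S) → (L2 S →L[ℂ] L2 S))) :
    ∀ A : L2 S →L[ℂ] L2 S, IsCompactOperator (⇑A) → IsCompactOperator ⇑(T A) := by
  intro A hA
  refine (T.hasSum hA.hasSum_projStd_mul).isCompactOperator fun s => ?_
  refine (T.hasSum (hasSum_projStd_mul_mul_projStd s A)).isCompactOperator fun s' => ?_
  rw [hSchur]
  exact (isCompactOperator_projStd s').clm_comp (projStd s * T A)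
end

section
/- Let S be a set and let k : S × S → ℂ be a positive definite kernel (∑_{i,j} conj(z_i) k(s_i, s_j) z_j ≥ 0 for all finitely many s_i ∈ S, z_i ∈ ℂ) which is bounded, i.e., there is M ≥ 0 with |k(s,s')| ≤ M for all s, s' ∈ S. Then on H = ℓ²(S) there exists a unique completely positive bounded linear Schur map T : B(H) → B(H) such that T(|e_s⟩⟨e_{s'}|) = k(s,s') |e_s⟩⟨e_{s'}| for all s, s' ∈ S, where |e_s⟩⟨e_{s'}| is the rank-one operator x ↦ ⟨e_{s'}, x⟩ e_s; moreover ‖T‖ ≤ M. -/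
open scoped ComplexOrder

/-- A kernel `k : S × S → ℂ` is *positive definite* if
`∑_{i,j} conj(zᵢ) k(sᵢ,sⱼ) zⱼ ≥ 0` for all finite families `sᵢ ∈ S`, `zᵢ ∈ ℂ`. -/
def IsPosDefKernel {S : Type*} (k : S × S → ℂ) : Prop :=
  ∀ (n : ℕ) (s : Fin n → S) (z : Fin n → ℂ),
    0 ≤ ∑ i, ∑ j, starRingEnd ℂ (z i) * k (s i, s j) * z j


open scoped InnerProductSpace

universe u

namespace IsPosDefKernel

theorem conj_apply {S : Type*} {k : S × S → ℂ} (hk : IsPosDefKernel k) (s t : S) :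
    starRingEnd ℂ (k (s, t)) = k (t, s) := by
  have diag (u : S) : (k (u, u)).im = 0 := by
    simpa using (Complex.nonneg_iff.1 (hk 1 ![u] ![1])).2.symm
  have h₁ := (Complex.nonneg_iff.1 (hk 2 ![s, t] ![1, 1])).2
  have h₂ := (Complex.nonneg_iff.1 (hk 2 ![s, t] ![1, Complex.I])).2
  simp [Fin.sum_univ_two, diag] at h₁ h₂
  apply Complex.ext
  · simp; linarith
  · simp; linarith

/-- The Kolmogorov decomposition of a positive definite kernel, in coordinates. -/
theorem exists_inner_eq {S : Type u} {k : S × S → ℂ} (hk : IsPosDefKernel k) :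
    ∃ (R : Type u) (c : S → lp (fun _ : R => ℂ) 2), ∀ s t, ⟪c s, c t⟫_ℂ = k (s, t) := by
  let K : Matrix S S (ℂ →L[ℂ] ℂ) := .of fun s t => k (s, t) • 1
  have hK : K.PosSemidef := by
    have tfae := (RKHS.posSemidef_tfae (K := K)).out 0 2
    refine tfae.2 ⟨?_, fun v => ?_⟩
    · ext s t
      simp [K, Matrix.conjTranspose_apply, ← hk.conj_apply t s]
    · let e := v.support.equivFin.symm
      have h := (Complex.nonneg_iff.1 (hk _ (fun i => (e i : S)) fun i => v (e i))).1
      rw [e.sum_comp (fun i : v.support => ∑ j, starRingEnd ℂ (v i) * k (i, e j) * v (e j)),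
        Finset.sum_coe_sort v.support
          (fun s => ∑ j, starRingEnd ℂ (v s) * k (s, e j) * v (e j))] at h
      convert! h using 2
      refine Finset.sum_congr rfl fun s _ => ?_
      rw [e.sum_comp (fun j : v.support => starRingEnd ℂ (v s) * k (s, j) * v j),
        Finset.sum_coe_sort v.support (fun t => starRingEnd ℂ (v s) * k (s, t) * v t)]
      refine Finset.sum_congr rfl fun t _ => ?_
      simp [K, hk.conj_apply]
      ring
  have : Fact K.PosSemidef := ⟨hK⟩
  obtain ⟨R, b, -⟩ := exists_hilbertBasis ℂ (RKHS.OfKernel K)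
  refine ⟨R, fun s => b.repr (RKHS.kerFun (RKHS.OfKernel K) s 1), fun s t => ?_⟩
  rw [b.repr.inner_map_map, ← ContinuousLinearMap.adjoint_inner_right,
    ← ContinuousLinearMap.comp_apply, ← RKHS.kernel_apply, RKHS.OfKernel.kernel_ofKernel]
  simp [K]

end IsPosDefKernel

section Ampliation

variable (R : Type*) {E : Type*} [NormedAddCommGroup E] [InnerProductSpace ℂ E]

/-- The ampliation `1 ⊗ A` of an operator `A`, acting coordinatewise on `ℓ²(R; E)`. -/
noncomputable def ampliation (A : E →L[ℂ] E) :
    lp (fun _ : R => E) 2 →L[ℂ] lp (fun _ : R => E) 2 :=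
  LinearMap.mkContinuous
    { toFun := fun f => ⟨fun r => A (f r), by
        refine ((lp.memℓp f).const_smul (‖A‖ : ℂ)).mono' fun r => ?_
        simpa [norm_smul] using A.le_opNorm (f r)⟩
      map_add' := fun f g => by ext r; exact map_add A _ _
      map_smul' := fun a f => by ext r; exact map_smul A _ _ } ‖A‖ fun f => by
    have h : ‖(‖A‖ : ℂ) • f‖ = ‖A‖ * ‖f‖ := by
      rw [lp.norm_const_smul two_ne_zero, Complex.norm_real, norm_norm]
    rw [← h]
    refine lp.norm_mono two_ne_zero fun r => ?_
    rw [lp.coeFn_smul, Pi.smul_apply, norm_smul, Complex.norm_real]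
    exact (A.le_opNorm (f r)).trans_eq (by rw [norm_norm])

@[simp]
theorem ampliation_apply (A : E →L[ℂ] E) (f : lp (fun _ : R => E) 2) (r : R) :
    ampliation R A f r = A (f r) := rfl

theorem norm_ampliation_le (A : E →L[ℂ] E) : ‖ampliation R A‖ ≤ ‖A‖ :=
  LinearMap.mkContinuous_norm_le _ (norm_nonneg A) _

theorem inner_ampliation_star_mul [CompleteSpace E] (A B : E →L[ℂ] E)
    (f g : lp (fun _ : R => E) 2) :
    ⟪f, ampliation R (star A * B) g⟫_ℂ = ⟪ampliation R A f, ampliation R B g⟫_ℂ := by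
  simp [lp.inner_eq_tsum, ContinuousLinearMap.star_eq_adjoint,
    ContinuousLinearMap.adjoint_inner_right]

end Ampliation

section CoordMul

variable {S R : Type*} (c : S → lp (fun _ : R => ℂ) 2) {C : ℝ} (hc : ∀ s, ‖c s‖ ≤ C)

/-- Multiplication by the `r`-th coordinate function of `c`. -/
noncomputable def coordMulAt (r : R) (x : lp (fun _ : S => ℂ) 2) : lp (fun _ : S => ℂ) 2 :=
  ⟨fun s => c s r * x s, by
    refine ((lp.memℓp x).const_smul (C : ℂ)).mono' fun s => ?_
    have h := (lp.norm_apply_le_norm two_ne_zero (c s) r).trans (hc s)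
    simpa using mul_le_mul_of_nonneg_right (h.trans (le_abs_self C)) (norm_nonneg (x s))⟩

@[simp]
theorem coordMulAt_apply (r : R) (x : lp (fun _ : S => ℂ) 2) (s : S) :
    coordMulAt c hc r x s = c s r * x s := rfl

theorem sum_norm_coordMulAt_le (F : Finset R) (x : lp (fun _ : S => ℂ) 2) :
    ∑ r ∈ F, ‖coordMulAt c hc r x‖ ^ (2 : ENNReal).toReal ≤
      (C * ‖x‖) ^ (2 : ENNReal).toReal := by
  have h2 : 0 < (2 : ENNReal).toReal := by simp
  have hx := (lp.hasSum_norm h2 x).mul_left (C ^ 2)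
  have hF := hasSum_sum fun r (_ : r ∈ F) => lp.hasSum_norm h2 (coordMulAt c hc r x)
  refine (hasSum_le (fun s => ?_) hF hx).trans_eq (by simp [mul_pow])
  have hs := (lp.sum_rpow_le_norm_rpow h2 (c s) F)
  simp only [ENNReal.toReal_ofNat, Real.rpow_ofNat, coordMulAt_apply, norm_mul, mul_pow,
    ← Finset.sum_mul] at hs ⊢
  gcongr
  exact hs.trans (pow_le_pow_left₀ (norm_nonneg _) (hc s) 2)

/-- The column operator `x ↦ (s ↦ c s r * x s)_r` from `ℓ²(S)` to `ℓ²(R; ℓ²(S))`. -/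
noncomputable def coordMul (hC : 0 ≤ C) :
    lp (fun _ : S => ℂ) 2 →L[ℂ] lp (fun _ : R => lp (fun _ : S => ℂ) 2) 2 :=
  LinearMap.mkContinuous
    { toFun := fun x => ⟨fun r => coordMulAt c hc r x,
        memℓp_gen' fun F => sum_norm_coordMulAt_le c hc F x⟩
      map_add' := fun x y => by ext r s; exact mul_add _ _ _
      map_smul' := fun a x => by ext r s; exact mul_left_comm _ _ _ } C fun x =>
    lp.norm_le_of_forall_sum_le (by simp) (by positivity)
      fun F => sum_norm_coordMulAt_le c hc F x

@[simp]
theorem coordMul_apply (hC : 0 ≤ C) (x : lp (fun _ : S => ℂ) 2) (r : R) :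
    coordMul c hc hC x r = coordMulAt c hc r x := rfl

theorem norm_coordMul_le (hC : 0 ≤ C) : ‖coordMul c hc hC‖ ≤ C :=
  LinearMap.mkContinuous_norm_le _ hC _

end CoordMul

section StandardBasis

variable {S : Type*} [DecidableEq S]

theorem inner_stdONB_left (s : S) (x : L2 S) : ⟪stdONB s, x⟫_ℂ = x s := by
  simp [stdONB, lp.inner_single_left]

theorem inner_stdONB (s t : S) : ⟪stdONB s, stdONB t⟫_ℂ = if s = t then 1 else 0 := by
  rw [inner_stdONB_left]
  simp [stdONB, lp.single_apply, Pi.single_apply]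

theorem rankOneStd_apply (s t : S) (x : L2 S) :
    rankOneStd s t x = ⟪stdONB t, x⟫_ℂ • stdONB s := by
  simp [rankOneStd]

theorem ext_inner_stdONB {A B : L2 S →L[ℂ] L2 S}
    (h : ∀ s t, ⟪stdONB s, A (stdONB t)⟫_ℂ = ⟪stdONB s, B (stdONB t)⟫_ℂ) : A = B := by
  refine lp.ext_continuousLinearMap (by simp) fun t => ?_
  ext s
  have h' := h s t
  rw [inner_stdONB_left, inner_stdONB_left] at h'
  exact h'

theorem projStd_mul_mul_projStd (A : L2 S →L[ℂ] L2 S) (s t : S) :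
    projStd s * A * projStd t = ⟪stdONB s, A (stdONB t)⟫_ℂ • rankOneStd s t := by
  ext1 x
  simp [projStd, rankOneStd_apply, smul_smul, mul_comm]

theorem inner_projStd_mul_mul_projStd (A : L2 S →L[ℂ] L2 S) (s t : S) :
    ⟪stdONB s, (projStd s * A * projStd t) (stdONB t)⟫_ℂ = ⟪stdONB s, A (stdONB t)⟫_ℂ := by
  rw [projStd_mul_mul_projStd, _root_.smul_apply, rankOneStd_apply, inner_smul_right,
    inner_smul_right, inner_stdONB, inner_stdONB]
  simp

theorem coordMulAt_stdONB {R : Type*} (c : S → lp (fun _ : R => ℂ) 2) {C : ℝ}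
    (hc : ∀ s, ‖c s‖ ≤ C) (r : R) (s : S) :
    coordMulAt c hc r (stdONB s) = c s r • stdONB s := by
  ext t
  by_cases h : t = s
  · subst h; simp
  · simp [stdONB, Pi.single_eq_of_ne h]

/-- A Schur map is determined by its values on matrix units. -/
theorem IsSchurOnL2.eq_of_rankOneStd {T T' : (L2 S →L[ℂ] L2 S) →L[ℂ] (L2 S →L[ℂ] L2 S)}
    (hT : IsSchurOnL2 T) (hT' : IsSchurOnL2 T')
    (h : ∀ s t, T (rankOneStd s t) = T' (rankOneStd s t)) : T = T' := by
  ext1 A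
  refine ext_inner_stdONB fun s t => ?_
  rw [← inner_projStd_mul_mul_projStd, ← hT, ← inner_projStd_mul_mul_projStd (T' A), ← hT',
    projStd_mul_mul_projStd, map_smul, map_smul, h]

end StandardBasis

section SchurMultiplier

variable {S R : Type*} (c : S → lp (fun _ : R => ℂ) 2) {C : ℝ} (hc : ∀ s, ‖c s‖ ≤ C)
  (hC : 0 ≤ C)

/-- The Schur multiplier `A ↦ V* (1 ⊗ A) V` with `V = coordMul c`; its symbol is the Gram
kernel of `c`. -/
noncomputable def schurMultiplier :
    (L2 S →L[ℂ] L2 S) →L[ℂ] (L2 S →L[ℂ] L2 S) :=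
  LinearMap.mkContinuous
    { toFun := fun A => (coordMul c hc hC).adjoint ∘L ampliation R A ∘L coordMul c hc hC
      map_add' := fun A B => by
        have h : ampliation R (A + B) = ampliation R A + ampliation R B := rfl
        simp [h, ContinuousLinearMap.add_comp, ContinuousLinearMap.comp_add]
      map_smul' := fun a A => by
        have h : ampliation R (a • A) = a • ampliation R A := rfl
        simp [h] } (C ^ 2) fun A => by
    calc _ ≤ ‖(coordMul c hc hC).adjoint‖ * (‖ampliation R A‖ * ‖coordMul c hc hC‖) :=
          (ContinuousLinearMap.opNorm_comp_le _ _).trans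
            (mul_le_mul_of_nonneg_left (ContinuousLinearMap.opNorm_comp_le _ _) (norm_nonneg _))
      _ ≤ C * (‖A‖ * C) := by
          rw [LinearIsometryEquiv.norm_map]
          gcongr
          exacts [norm_coordMul_le c hc hC, norm_ampliation_le R A, norm_coordMul_le c hc hC]
      _ = C ^ 2 * ‖A‖ := by ring

theorem norm_schurMultiplier_le : ‖schurMultiplier c hc hC‖ ≤ C ^ 2 :=
  LinearMap.mkContinuous_norm_le _ (sq_nonneg C) _

theorem schurMultiplier_apply (A : L2 S →L[ℂ] L2 S) :
    schurMultiplier c hc hC A =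
      (coordMul c hc hC).adjoint ∘L ampliation R A ∘L coordMul c hc hC := by
  simp only [schurMultiplier, LinearMap.mkContinuous_apply, LinearMap.coe_mk, AddHom.coe_mk]

theorem inner_schurMultiplier (A : L2 S →L[ℂ] L2 S) (x y : L2 S) :
    ⟪x, schurMultiplier c hc hC A y⟫_ℂ =
      ⟪coordMul c hc hC x, ampliation R A (coordMul c hc hC y)⟫_ℂ := by
  rw [schurMultiplier_apply, ContinuousLinearMap.comp_apply,
    ContinuousLinearMap.adjoint_inner_right, ContinuousLinearMap.comp_apply]

theorem isCPonL2_schurMultiplier : IsCPonL2 (schurMultiplier c hc hC) := by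
  intro m a b
  rw [ContinuousLinearMap.isPositive_iff_complex]
  intro x
  let w := ∑ l, ampliation R (a l) (coordMul c hc hC (b l x))
  have h : ⟪x, (∑ k, ∑ l, star (b k) * schurMultiplier c hc hC (star (a k) * a l) * b l) x⟫_ℂ =
      ⟪w, w⟫_ℂ := by
    simp only [w, sum_inner, inner_sum, _root_.sum_apply,
      ContinuousLinearMap.star_eq_adjoint (b _), FunLike.coe_mul_eq_comp, Function.comp_apply,
      ContinuousLinearMap.adjoint_inner_right, inner_schurMultiplier, inner_ampliation_star_mul]
    exact Finset.sum_comm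
  rw [← inner_conj_symm, h, inner_conj_symm, inner_self_eq_norm_sq_to_K]
  norm_cast
  simp

variable [DecidableEq S]

theorem inner_stdONB_schurMultiplier (A : L2 S →L[ℂ] L2 S) (s t : S) :
    ⟪stdONB s, schurMultiplier c hc hC A (stdONB t)⟫_ℂ =
      ⟪c s, c t⟫_ℂ * ⟪stdONB s, A (stdONB t)⟫_ℂ := by
  rw [inner_schurMultiplier, lp.inner_eq_tsum, lp.inner_eq_tsum, ← tsum_mul_right]
  refine tsum_congr fun r => ?_
  simp [coordMulAt_stdONB, inner_smul_left, inner_smul_right]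
  ring

theorem schurMultiplier_rankOneStd (s t : S) :
    schurMultiplier c hc hC (rankOneStd s t) = ⟪c s, c t⟫_ℂ • rankOneStd s t := by
  refine ext_inner_stdONB fun u v => ?_
  rw [inner_stdONB_schurMultiplier]
  by_cases hu : u = s
  · by_cases hv : t = v
    · simp [hu, hv]
    · simp [rankOneStd_apply, inner_stdONB, hv]
  · rw [_root_.smul_apply, rankOneStd_apply, inner_smul_right, inner_smul_right,
      inner_smul_right, inner_stdONB u s, if_neg hu]
    simp

theorem isSchurOnL2_schurMultiplier : IsSchurOnL2 (schurMultiplier c hc hC) := by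
  intro A s t
  rw [projStd_mul_mul_projStd, projStd_mul_mul_projStd, map_smul, schurMultiplier_rankOneStd,
    inner_stdONB_schurMultiplier, smul_smul, mul_comm]

end SchurMultiplier

/-- A bounded positive definite kernel `k` on `S` (with `|k| ≤ M`)
induces a unique completely positive bounded linear Schur map `T` on `B(ℓ²(S))` with
`T(|e_s⟩⟨e_{s'}|) = k(s,s') |e_s⟩⟨e_{s'}|`; moreover `‖T‖ ≤ M`. -/
theorem schur_cp_map_of_bounded_posDef_kernel {S : Type*} [DecidableEq S]
    (k : S × S → ℂ) (hk : IsPosDefKernel k)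
    (M : ℝ) (hM : 0 ≤ M) (hbdd : ∀ p : S × S, ‖k p‖ ≤ M) :
    ∃ T : (L2 S →L[ℂ] L2 S) →L[ℂ] (L2 S →L[ℂ] L2 S),
      (IsCPonL2 (T : (L2 S →L[ℂ] L2 S) → (L2 S →L[ℂ] L2 S)) ∧
        IsSchurOnL2 (T : (L2 S →L[ℂ] L2 S) → (L2 S →L[ℂ] L2 S)) ∧
        (∀ s s' : S, T (rankOneStd s s') = k (s, s') • rankOneStd s s') ∧
        ‖T‖ ≤ M) ∧
      ∀ T' : (L2 S →L[ℂ] L2 S) →L[ℂ] (L2 S →L[ℂ] L2 S),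
        (IsCPonL2 (T' : (L2 S →L[ℂ] L2 S) → (L2 S →L[ℂ] L2 S)) ∧
          IsSchurOnL2 (T' : (L2 S →L[ℂ] L2 S) → (L2 S →L[ℂ] L2 S)) ∧
          ∀ s s' : S, T' (rankOneStd s s') = k (s, s') • rankOneStd s s') → T' = T := by
  obtain ⟨R, c, hck⟩ := hk.exists_inner_eq
  have hc (s : S) : ‖c s‖ ≤ √M := by
    refine Real.le_sqrt_of_sq_le ?_
    have h : ‖⟪c s, c s⟫_ℂ‖ ≤ M := hck s s ▸ hbdd (s, s)
    rw [inner_self_eq_norm_sq_to_K] at h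
    simpa using h
  have hM' := Real.sqrt_nonneg M
  refine ⟨schurMultiplier c hc hM', ⟨isCPonL2_schurMultiplier c hc hM',
    isSchurOnL2_schurMultiplier c hc hM', fun s t => ?_, ?_⟩, fun T' hT' => ?_⟩
  · rw [schurMultiplier_rankOneStd, hck]
  · exact (norm_schurMultiplier_le c hc hM').trans_eq (Real.sq_sqrt hM)
  · refine hT'.2.1.eq_of_rankOneStd (isSchurOnL2_schurMultiplier c hc hM') fun s t => ?_
    rw [hT'.2.2, schurMultiplier_rankOneStd, hck]
end

section
/- Let S be a set, H = ℓ²(S), and let T : B(H) → B(H) be a completely positive bounded linear Schur map with respect to the standard orthonormal basis (e_s)_{s∈S}. Define k : S × S → ℂ by k(s,s') := ⟨e_s, T(|e_s⟩⟨e_{s'}|) e_{s'}⟩, where |e_s⟩⟨e_{s'}| is the rank-one operator x ↦ ⟨e_{s'}, x⟩ e_s. Then k is a positive definite kernel and |k(s,s')| ≤ ‖T‖ for all s, s' ∈ S. -/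
open scoped ComplexOrder

theorem rankOneStd_eq_rankOne {S : Type*} [DecidableEq S] (s s' : S) :
    rankOneStd s s' = InnerProductSpace.rankOne ℂ (stdONB s) (stdONB s') := rfl

theorem norm_stdONB {S : Type*} [DecidableEq S] (s : S) : ‖stdONB s‖ = 1 := by
  simp [stdONB, lp.norm_single]

theorem norm_rankOneStd {S : Type*} [DecidableEq S] (s s' : S) : ‖rankOneStd s s'‖ = 1 := by
  simp [rankOneStd_eq_rankOne, norm_stdONB]

theorem star_rankOneStd {S : Type*} [DecidableEq S] (s s' : S) :
    star (rankOneStd s s') = rankOneStd s' s := by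
  simp [rankOneStd_eq_rankOne, ContinuousLinearMap.star_eq_adjoint]

theorem rankOneStd_mul_rankOneStd {S : Type*} [DecidableEq S] (s t s' : S) :
    rankOneStd s t * rankOneStd t s' = rankOneStd s s' := by
  simp [rankOneStd_eq_rankOne, ContinuousLinearMap.mul_def,
    InnerProductSpace.rankOne_comp_rankOne, norm_stdONB]

theorem rankOneStd_apply_stdONB {S : Type*} [DecidableEq S] (s t : S) :
    rankOneStd s t (stdONB t) = stdONB s := by
  simp [rankOneStd_eq_rankOne, norm_stdONB]

/-- The kernel of a completely positive map is positive definite. -/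
theorem IsCPonL2.isPosDefKernel {S : Type*} [DecidableEq S]
    {T : (L2 S →L[ℂ] L2 S) → (L2 S →L[ℂ] L2 S)} (hT : IsCPonL2 T) :
    IsPosDefKernel (fun p : S × S =>
      inner ℂ (stdONB p.1) (T (rankOneStd p.1 p.2) (stdONB p.2))) := by
  intro n s z
  rcases n with _ | n
  · simp
  have h := (hT (n + 1) (fun k => rankOneStd (s 0) (s k))
    (fun k => z k • rankOneStd (s k) (s 0))).inner_nonneg_right (stdONB (s 0))
  convert h using 1
  simp only [sum_apply, inner_sum]
  refine Finset.sum_congr rfl fun k _ => Finset.sum_congr rfl fun l _ => ?_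
  rw [star_rankOneStd, rankOneStd_mul_rankOneStd, mul_apply_eq_comp,
    mul_apply_eq_comp, ContinuousLinearMap.star_eq_adjoint,
    ContinuousLinearMap.adjoint_inner_right, smul_apply,
    smul_apply, rankOneStd_apply_stdONB, rankOneStd_apply_stdONB,
    map_smul, inner_smul_left, inner_smul_right]
  ring

/-- For a completely positive bounded linear Schur map `T` on
`B(ℓ²(S))`, the kernel `k(s,s') = ⟨e_s, T(|e_s⟩⟨e_{s'}|) e_{s'}⟩` is positive definite
and bounded by `‖T‖`. -/
theorem posDef_kernel_of_schur_cp_map {S : Type*} [DecidableEq S]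
    (T : (L2 S →L[ℂ] L2 S) →L[ℂ] (L2 S →L[ℂ] L2 S))
    (hCP : IsCPonL2 (T : (L2 S →L[ℂ] L2 S) → (L2 S →L[ℂ] L2 S)))
    (hSchur : IsSchurOnL2 (T : (L2 S →L[ℂ] L2 S) → (L2 S →L[ℂ] L2 S))) :
    IsPosDefKernel (fun p : S × S =>
      @inner ℂ _ _ (stdONB p.1) (T (rankOneStd p.1 p.2) (stdONB p.2))) ∧
    ∀ p : S × S,
      ‖@inner ℂ _ _ (stdONB p.1) (T (rankOneStd p.1 p.2) (stdONB p.2))‖ ≤ ‖T‖ := by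
  refine ⟨hCP.isPosDefKernel, fun p => ?_⟩
  calc _ ≤ ‖stdONB p.1‖ * ‖T (rankOneStd p.1 p.2) (stdONB p.2)‖ := norm_inner_le_norm _ _
    _ = ‖T (rankOneStd p.1 p.2) (stdONB p.2)‖ := by rw [norm_stdONB, one_mul]
    _ ≤ ‖T (rankOneStd p.1 p.2)‖ :=
      ContinuousLinearMap.unit_le_opNorm _ _ (norm_stdONB p.2).le
    _ ≤ ‖T‖ := ContinuousLinearMap.unit_le_opNorm _ _ (norm_rankOneStd p.1 p.2).le
end
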